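/- arXiv:1401.7955 — 3 statements merged into one kernel-verified Lean document; each statement's English description precedes it below -/
import Mathlib

section
/- Let G be a metabelian 2-group with G/G' of type (2,4), and M the maximal subgroup of G with M/G' of type (2,2). Then the following are equivalent: (1) G is not metacyclic; (2) M/M' ≅ ℤ/2ℤ × ℤ/2ℤ × ℤ/2ℤ; (3) the minimal number of generators of M is 3. -/
/-- A group is metacyclic if it has a cyclic normal subgroup with cyclic quotient. -/
def IsMetacyclic (G : Type*) [Group G] : Prop :=
  ∃ (N : Subgroup G) (hN : N.Normal), IsCyclic ↥N ∧ (letI := hN; IsCyclic (G ⧸ N))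

open Subgroup in
def MetaMod (G : Type*) [Group G] (K : Subgroup G) : Prop :=
  ∃ l g : G, (zpowers l ⊔ K).Normal ∧ zpowers g ⊔ (zpowers l ⊔ K) = ⊤

open scoped commutatorElement in
def NN (G : Type*) [Group G] : Subgroup G :=
  Subgroup.closure {x | ∃ u ∈ commutator G, x = u ^ 2 ∨ ∃ y, x = ⁅u, y⁆}

section
open Subgroup
open scoped commutatorElement
variable {G : Type*} [Group G]

lemma sq_mem_NN {u : G} (hu : u ∈ commutator G) : u ^ 2 ∈ NN G :=
  Subgroup.subset_closure ⟨u, hu, Or.inl rfl⟩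

lemma comm_mem_NN {u : G} (hu : u ∈ commutator G) (y : G) : ⁅u, y⁆ ∈ NN G :=
  Subgroup.subset_closure ⟨u, hu, Or.inr ⟨y, rfl⟩⟩

lemma commutator_map_mem {H : Type*} [Group H] (f : G →* H) {u : G} (hu : u ∈ commutator G) :
    f u ∈ commutator H := by
  have : (commutator G).map f ≤ commutator H := by
    rw [commutator_def, map_commutator, commutator_def]
    exact commutator_mono le_top le_top
  exact this (mem_map_of_mem f hu)

lemma NN_map {H : Type*} [Group H] (f : G →* H) {x : G} (hx : x ∈ NN G) : f x ∈ NN H := by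
  have : NN G ≤ (NN H).comap f := by
    rw [NN, closure_le]
    rintro x ⟨u, hu, rfl | ⟨y, rfl⟩⟩
    · simp only [SetLike.mem_coe, mem_comap, map_pow]
      exact sq_mem_NN (commutator_map_mem f hu)
    · simp only [SetLike.mem_coe, mem_comap, map_commutatorElement]
      exact comm_mem_NN (commutator_map_mem f hu) _
  exact this hx

instance NN_normal : (NN G).Normal := by
  constructor
  intro n hn g
  exact NN_map (MulAut.conj g).toMonoidHom hn

lemma NN_le : NN G ≤ commutator G := by
  rw [NN, closure_le]
  rintro x ⟨u, hu, rfl | ⟨y, rfl⟩⟩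
  · exact pow_mem hu 2
  · exact commutator_mem_commutator (mem_top u) (mem_top y)

lemma comm_mem_iff (T : Subgroup G) [T.Normal] (x y : G) :
    ⁅x, y⁆ ∈ T ↔ x ∈ (centralizer {QuotientGroup.mk' T y}).comap (QuotientGroup.mk' T) := by
  rw [mem_comap, mem_centralizer_singleton_iff, ← QuotientGroup.eq_one_iff]
  change QuotientGroup.mk' T _ = 1 ↔ _
  rw [map_commutatorElement, commutatorElement_eq_one_iff_mul_comm]

lemma comm_symm_mem (T : Subgroup G) {x y : G} (h : ⁅x, y⁆ ∈ T) : ⁅y, x⁆ ∈ T := by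
  rw [← commutatorElement_inv]; exact inv_mem h

lemma lemA (T : Subgroup G) [T.Normal] (X : Set G)
    (h : ∀ x ∈ X, ∀ y ∈ X, ⁅x, y⁆ ∈ T) : ⁅closure X, closure X⁆ ≤ T := by
  have h1 : ∀ y ∈ X, ∀ x ∈ closure X, ⁅x, y⁆ ∈ T := by
    intro y hy x hx
    rw [comm_mem_iff]
    refine (closure_le _).2 ?_ hx
    intro x hx
    exact (comm_mem_iff T x y).1 (h x hx y hy)
  rw [commutator_le]
  intro x hx y hy
  rw [comm_mem_iff]
  refine (closure_le _).2 ?_ hx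
  intro x hx
  exact (comm_mem_iff T x y).1 (comm_symm_mem T (h1 x hx y hy))

lemma lemA' (T : Subgroup G) [T.Normal] (X : Set G) (hX : closure X = ⊤)
    (h : ∀ x ∈ X, ∀ y ∈ X, ⁅x, y⁆ ∈ T) : commutator G ≤ T := by
  have := lemA T X h
  rwa [hX] at this

lemma lemB (t : G) (hT : (zpowers t).Normal) (hc : commutator G ≤ zpowers t) :
    NN G ≤ zpowers (t ^ 2) := by
  have hconj : ∀ y : G, ∃ k : ℤ, y * t * y⁻¹ = t ^ k := fun y => by
    obtain ⟨k, hk⟩ := hT.conj_mem t (mem_zpowers t) y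
    exact ⟨k, hk.symm⟩
  rw [NN, closure_le]
  rintro x ⟨u, hu, rfl | ⟨y, rfl⟩⟩
  · obtain ⟨i, rfl⟩ := hc hu
    refine ⟨i, ?_⟩
    simp only [← zpow_natCast, ← zpow_mul]
    rw [mul_comm]
  · obtain ⟨i, rfl⟩ := hc hu
    obtain ⟨k, hk⟩ := hconj y
    have e : ⁅t ^ i, y⁆ = t ^ ((1 - k) * i) := by
      rw [commutatorElement_def, sub_mul, one_mul, zpow_sub, zpow_mul, ← hk, conj_zpow]
      group
    change ⁅t ^ i, y⁆ ∈ _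
    rw [e, zpow_mul]
    apply zpow_mem
    rcases Int.even_or_odd' k with ⟨m, rfl | rfl⟩
    · have ht : t ∈ zpowers (t ^ 2) := by
        obtain ⟨k', hk'⟩ := hconj y⁻¹
        refine ⟨m * k', ?_⟩
        have : t = y⁻¹ * t ^ (2 * m) * y⁻¹⁻¹ := by rw [← hk]; group
        have h2 : y⁻¹ * t ^ (2 * m) * y⁻¹⁻¹ = t ^ (k' * (2 * m)) := by
          rw [zpow_mul t k', ← hk', conj_zpow]
        conv_rhs => rw [this, h2]
        simp only [← zpow_natCast, ← zpow_mul]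
        congr 1
        push_cast; ring
      exact zpow_mem ht _
    · refine ⟨-m, ?_⟩
      simp only [← zpow_natCast, ← zpow_mul]
      congr 1
      push_cast; ring

lemma normal_zpowers_of_gen [Finite G] (t : G) (X : Set G) (hX : closure X = ⊤)
    (h : ∀ x ∈ X, x * t * x⁻¹ ∈ zpowers t) : (zpowers t).Normal := by
  rw [← normalizer_eq_top_iff, eq_top_iff, ← hX, closure_le]
  intro x hx
  have hle : (zpowers t).map (MulAut.conj x).toMonoidHom ≤ zpowers t := by
    rw [MonoidHom.map_zpowers, zpowers_le]
    exact h x hx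
  have heq : (zpowers t).map (MulAut.conj x).toMonoidHom = zpowers t := by
    apply Subgroup.eq_of_le_of_card_ge hle
    rw [card_map_of_injective (MulAut.conj x).injective]
  rw [SetLike.mem_coe, mem_normalizer_iff]
  intro n
  constructor
  · intro hn
    exact hle (mem_map_of_mem _ hn)
  · intro hn
    rw [← heq] at hn
    obtain ⟨m, hm, hm'⟩ := hn
    have : m = n := (MulAut.conj x).injective hm'
    exact this ▸ hm

lemma key [Finite G] (z : G) (hz : z ∈ center G) (hz2 : z ^ 2 = 1) (hzN : z ∈ NN G)
    (h : MetaMod G (zpowers z)) : MetaMod G ⊥ := by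
  obtain ⟨l, g, hL, hgen⟩ := h
  have hzc : ∀ w ∈ zpowers z, ∀ y, w * y = y * w := fun w hw y =>
    (mem_center_iff.1 ((zpowers_le.2 hz) hw) y).symm
  have hzn : (zpowers z).Normal := ⟨fun n hn y => by rw [← hzc n hn y]; simpa using hn⟩
  have hw2 : ∀ w ∈ zpowers z, w ^ 2 = 1 := by
    rintro _ ⟨j, rfl⟩
    change (z ^ j) ^ 2 = 1
    rw [← zpow_natCast, zpow_comm]; simp [hz2]
  set L := zpowers l ⊔ zpowers z with hLdef
  have hmem : ∀ x ∈ L, ∃ i : ℤ, ∃ w ∈ zpowers z, x = l ^ i * w := by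
    intro x hx
    obtain ⟨y, ⟨i, rfl⟩, w, hw, rfl⟩ := mem_sup_of_normal_right.1 hx
    exact ⟨i, w, hw, rfl⟩
  have hlL : l ∈ L := mem_sup_left (mem_zpowers l)
  have hab : ∀ x ∈ L, ∀ y ∈ L, Commute x y := by
    intro x hx y hy
    obtain ⟨i, w, hw, rfl⟩ := hmem x hx
    obtain ⟨j, v, hv, rfl⟩ := hmem y hy
    have c1 : ∀ y, Commute w y := hzc w hw
    have c2 : ∀ y, Commute y v := fun y => (hzc v hv y).symm
    exact ((((Commute.refl l).zpow_zpow i j).mul_right (c2 _))).mul_left (c1 _)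
  set t := ⁅l, g⁆ with ht
  have hphi : ∀ x ∈ L, ⁅x, g⁆ ∈ zpowers t := by
    intro x hx
    obtain ⟨i, w, hw, rfl⟩ := hmem x hx
    refine ⟨i, ?_⟩
    have c : Commute l (g * l⁻¹ * g⁻¹) := hab _ hlL _ (hL.conj_mem _ (inv_mem hlL) g)
    have e : t = l * (g * l⁻¹ * g⁻¹) := by rw [ht, commutatorElement_def]; group
    change t ^ i = _
    rw [e, c.mul_zpow, conj_zpow, commutatorElement_def, mul_inv_rev]
    have h1 := hzc w hw
    calc l ^ i * (g * l⁻¹ ^ i * g⁻¹) = l ^ i * (g * (w * w⁻¹) * l⁻¹ ^ i * g⁻¹) := by group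
      _ = l ^ i * ((w * g) * w⁻¹ * l⁻¹ ^ i * g⁻¹) := by rw [h1 g]; group
      _ = _ := by group
  have htL : t ∈ L := by
    rw [ht, commutatorElement_def, mul_assoc, mul_assoc]
    exact mul_mem hlL (by simpa [mul_assoc] using hL.conj_mem _ (inv_mem hlL) g)
  have hX : closure ({g} ∪ (L : Set G)) = ⊤ := by
    rw [Subgroup.closure_union, Subgroup.closure_eq, ← zpowers_eq_closure]; exact hgen
  have hT : (zpowers t).Normal := by
    apply normal_zpowers_of_gen t _ hX
    rintro x (rfl | hx)
    · have : x * t * x⁻¹ = ⁅x * l * x⁻¹, x⁆ := by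
        rw [ht, commutatorElement_def, commutatorElement_def]; group
      rw [this]
      exact hphi _ (hL.conj_mem _ hlL x)
    · rw [(hab x hx t htL).eq]; simp
  have hc : commutator G ≤ zpowers t := by
    apply lemA' _ _ hX
    rintro x (rfl | hx) y (rfl | hy)
    · simp
    · exact comm_symm_mem _ (hphi y hy)
    · exact hphi x hx
    · rw [commutatorElement_eq_one_iff_commute.2 (hab x hx y hy)]; exact one_mem _
  have hzl : z ∈ zpowers l := by
    have h1 := lemB t hT hc hzN
    obtain ⟨i, w, hw, hti⟩ := hmem t htL
    have : t ^ 2 ∈ zpowers l := by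
      have c : Commute (l ^ i) w := (hzc w hw _).symm
      rw [hti, c.mul_pow, hw2 w hw, mul_one]
      exact pow_mem (zpow_mem (mem_zpowers l) _) _
    exact (zpowers_le.2 this) h1
  have hLe : L = zpowers l ⊔ ⊥ := by
    rw [hLdef, sup_bot_eq, sup_eq_left, zpowers_le]; exact hzl
  exact ⟨l, g, hLe ▸ hL, hLe ▸ hgen⟩

lemma MetaMod.of_quot {Z : Subgroup G} [Z.Normal] (h : MetaMod (G ⧸ Z) ⊥) : MetaMod G Z := by
  obtain ⟨l, g, hL, hgen⟩ := h
  obtain ⟨l, rfl⟩ := QuotientGroup.mk'_surjective Z l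
  obtain ⟨g, rfl⟩ := QuotientGroup.mk'_surjective Z g
  have e : zpowers l ⊔ Z = (zpowers (QuotientGroup.mk' Z l) ⊔ ⊥).comap (QuotientGroup.mk' Z) := by
    rw [sup_bot_eq, ← MonoidHom.map_zpowers, comap_map_eq, QuotientGroup.ker_mk']
  refine ⟨l, g, ?_, ?_⟩
  · rw [e]; exact hL.comap _
  · apply_fun Subgroup.comap (QuotientGroup.mk' Z) at hgen
    rw [sup_bot_eq, ← MonoidHom.map_zpowers, ← MonoidHom.map_zpowers, ← Subgroup.map_sup, comap_map_eq,
      QuotientGroup.ker_mk', comap_top] at hgen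
    rw [← sup_assoc]; exact hgen

lemma MetaMod.quot {K : Subgroup G} (h : MetaMod G K) {H : Type*} [Group H] (f : G →* H)
    (hf : Function.Surjective f) : MetaMod H (K.map f) := by
  obtain ⟨l, g, hL, hgen⟩ := h
  refine ⟨f l, f g, ?_, ?_⟩
  · rw [← MonoidHom.map_zpowers, ← Subgroup.map_sup]; exact hL.map f hf
  · rw [← MonoidHom.map_zpowers, ← MonoidHom.map_zpowers, ← Subgroup.map_sup, ← Subgroup.map_sup, hgen,
      map_top_of_surjective f hf]

lemma MetaMod.isMeta (h : MetaMod G ⊥) : IsMetacyclic G := by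
  obtain ⟨l, g, hL, hgen⟩ := h
  rw [sup_bot_eq] at hL hgen
  refine ⟨zpowers l, hL, inferInstance, ?_⟩
  refine ⟨⟨QuotientGroup.mk' _ g, ?_⟩⟩
  intro x
  obtain ⟨x, rfl⟩ := QuotientGroup.mk'_surjective _ x
  have hx : x ∈ zpowers g ⊔ zpowers l := hgen ▸ mem_top x
  obtain ⟨y, ⟨i, rfl⟩, w, hw, rfl⟩ := mem_sup_of_normal_right.1 hx
  refine ⟨i, ?_⟩
  rw [map_mul, (QuotientGroup.eq_one_iff w).2 hw |> (fun h => (h : QuotientGroup.mk' (zpowers l) w = 1))]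
  simp

lemma exists_central [Finite G] (hG : IsPGroup 2 G) (K : Subgroup G) [K.Normal] (hK : K ≠ ⊥) :
    ∃ z ∈ K, z ∈ center G ∧ z ^ 2 = 1 ∧ z ≠ 1 := by
  have hKp : IsPGroup 2 K := hG.to_subgroup K
  have hnt : Nontrivial K := (nontrivial_iff_ne_bot K).2 hK
  have : Fact (Nat.Prime 2) := ⟨Nat.prime_two⟩
  have hdvd : 2 ∣ Nat.card K := by
    rcases hKp.card_eq_or_dvd with h | h
    · exact absurd h (Finite.one_lt_card).ne'
    · exact h
  have hC : IsPGroup 2 (ConjAct G) := hG.of_equiv ConjAct.toConjAct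
  obtain ⟨b, hb, hb1⟩ := hC.exists_fixed_point_of_prime_dvd_card_of_fixed_point K hdvd
    (a := 1) (by intro g; simp)
  have hbc : (b : G) ∈ center G := by
    rw [mem_center_iff]
    intro g
    have := congrArg (Subtype.val) (hb (ConjAct.toConjAct g))
    rw [ConjAct.Subgroup.val_conj_smul, ConjAct.toConjAct_smul] at this
    exact mul_inv_eq_iff_eq_mul.1 this
  have hI : K ⊓ center G ≠ ⊥ := by
    intro h
    have : (b : G) ∈ K ⊓ center G := ⟨b.2, hbc⟩
    rw [h, mem_bot] at this
    exact hb1 (Subtype.ext this.symm)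
  have hnt2 : Nontrivial ↥(K ⊓ center G) := (nontrivial_iff_ne_bot _).2 hI
  have hdvd2 : 2 ∣ Nat.card ↥(K ⊓ center G) := by
    rcases (hG.to_subgroup (K ⊓ center G)).card_eq_or_dvd with h | h
    · exact absurd h (Finite.one_lt_card).ne'
    · exact h
  obtain ⟨z, hz⟩ := exists_prime_orderOf_dvd_card' 2 hdvd2
  refine ⟨z, z.2.1, z.2.2, ?_, ?_⟩
  · have := pow_orderOf_eq_one z
    rw [hz] at this
    exact congrArg Subtype.val this
  · intro h
    have : z = 1 := Subtype.ext h
    rw [this] at hz; simp at hz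

lemma metaMod_lift_aux (n : ℕ) : ∀ (G : Type*) [Group G] [Finite G] (_ : IsPGroup 2 G)
    (K : Subgroup G) [K.Normal] (_ : K ≤ NN G) (_ : MetaMod G K) (_ : Nat.card G = n),
    MetaMod G ⊥ := by
  induction n using Nat.strong_induction_on with
  | _ n ih =>
  intro G _ _ hG K _ hKN h hn
  by_cases hK : K = ⊥
  · exact hK ▸ h
  obtain ⟨z, hzK, hzc, hz2, hz1⟩ := exists_central hG K hK
  have hzn : (zpowers z).Normal := ⟨fun n hn y => by
    rw [mem_center_iff.1 ((zpowers_le.2 hzc) hn) y]; simpa using hn⟩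
  apply key z hzc hz2 (hKN hzK)
  apply MetaMod.of_quot
  have hs := QuotientGroup.mk'_surjective (zpowers z)
  have : (K.map (QuotientGroup.mk' (zpowers z))).Normal := Normal.map inferInstance _ hs
  refine ih (Nat.card (G ⧸ zpowers z)) ?_ _ (hG.to_quotient _) (K.map (QuotientGroup.mk' _)) ?_
    (h.quot _ hs) rfl
  · rw [← hn, card_eq_card_quotient_mul_card_subgroup (zpowers z)]
    have : 1 < Nat.card (zpowers z) := by
      have : Nontrivial (zpowers z) := (nontrivial_iff_ne_bot _).2 (by simpa using hz1)
      exact Finite.one_lt_card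
    have h0 : 0 < Nat.card (G ⧸ zpowers z) := Nat.card_pos
    nlinarith
  · rintro _ ⟨x, hx, rfl⟩
    exact NN_map _ (hKN hx)

lemma metaMod_lift [Finite G] (hG : IsPGroup 2 G) (h : MetaMod G (NN G)) : IsMetacyclic G :=
  (metaMod_lift_aux _ G hG (NN G) le_rfl h rfl).isMeta

lemma nongen {G : Type*} [Group G] [Finite G] (hG : IsPGroup 2 G) (H : Subgroup G)
    (h : H ⊔ _root_.commutator G = ⊤) : H = ⊤ := by
  by_contra hH
  obtain ⟨K, hK, hHK⟩ := (eq_top_or_exists_le_coatom H).resolve_left hH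
  have : Fact (Nat.Prime 2) := ⟨Nat.prime_two⟩
  have hnil : Group.IsNilpotent G := hG.isNilpotent
  have hn : K.Normal := by
    have h02 := (Group.isNilpotent_of_finite_tfae (G := G)).out 0 2
    exact h02.1 hnil K hK
  have hnt : Nontrivial (G ⧸ K) := QuotientGroup.nontrivial_iff.2 hK.1
  have hbot := (hG.to_quotient K).bot_lt_center
  have hlt : K < (center (G ⧸ K)).comap (QuotientGroup.mk' K) := by
    have h1 : (⊥ : Subgroup (G ⧸ K)).comap (QuotientGroup.mk' K) = K := by
      rw [MonoidHom.comap_bot, QuotientGroup.ker_mk']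
    conv_lhs => rw [← h1]
    exact (comap_lt_comap_of_surjective (QuotientGroup.mk'_surjective K)).2 hbot
  have htop := hK.2 _ hlt
  have hc : _root_.commutator G ≤ K := by
    rw [_root_.commutator_def, commutator_le]
    intro x _ y _
    rw [← QuotientGroup.eq_one_iff]
    change QuotientGroup.mk' K _ = 1
    rw [map_commutatorElement, commutatorElement_eq_one_iff_mul_comm]
    have : y ∈ (center (G ⧸ K)).comap (QuotientGroup.mk' K) := htop ▸ mem_top y
    exact mem_center_iff.1 this _
  exact hK.1 (top_le_iff.1 (h ▸ sup_le hHK hc))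

lemma normal_of_le (T : Subgroup G) (h1 : NN G ≤ T) (h2 : T ≤ _root_.commutator G) : T.Normal := by
  constructor
  intro x hx y
  have : y * x * y⁻¹ = ⁅y, x⁆ * x := by rw [commutatorElement_def]; group
  rw [this]
  exact mul_mem (h1 (comm_symm_mem _ (comm_mem_NN (h2 hx) y))) hx

lemma normal_of_ge (T : Subgroup G) (h1 : _root_.commutator G ≤ T) : T.Normal := by
  constructor
  intro x hx y
  have : y * x * y⁻¹ = ⁅y, x⁆ * x := by rw [commutatorElement_def]; group
  rw [this]
  exact mul_mem (h1 (commutator_mem_commutator (mem_top _) (mem_top _))) hx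

lemma mainA [Finite G] (hG : IsPGroup 2 G) (a b : G) (hgen : closure {a, b} = ⊤)
    (M : Subgroup G) (hM : M = closure ({a, b ^ 2} ∪ (_root_.commutator G : Set G)))
    (ha : a ^ 2 ∈ _root_.commutator G) (hb : b ^ 4 ∈ _root_.commutator G)
    (hmeta : ¬ MetaMod G (NN G)) :
    ⁅a, b⁆ ∉ ⁅M, M⁆ ∧
    (∀ x ∈ _root_.commutator G, x ∈ ⁅M, M⁆ ∨ ⁅a, b⁆⁻¹ * x ∈ ⁅M, M⁆) ∧
    ∀ x ∈ M, x ^ 2 ∈ ⁅M, M⁆ := by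
  set c := ⁅a, b⁆ with hc
  have hcG : c ∈ _root_.commutator G := commutator_mem_commutator (mem_top _) (mem_top _)
  have hTn : (zpowers c ⊔ NN G).Normal :=
    normal_of_le _ le_sup_right (sup_le (zpowers_le.2 hcG) NN_le)
  have hG1 : _root_.commutator G ≤ zpowers c ⊔ NN G := by
    apply lemA' _ _ hgen
    have hcT : c ∈ zpowers c ⊔ NN G := mem_sup_left (mem_zpowers c)
    rintro x (rfl | rfl) y (rfl | rfl)
    · simp
    · exact hcT
    · exact comm_symm_mem _ hcT
    · simp
  have hsplit : ∀ x ∈ _root_.commutator G, x ∈ NN G ∨ c⁻¹ * x ∈ NN G := by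
    intro x hx
    obtain ⟨y, ⟨i, rfl⟩, w, hw, rfl⟩ := mem_sup_of_normal_right.1 (hG1 hx)
    have hc2 := sq_mem_NN hcG
    rcases Int.even_or_odd' i with ⟨m, rfl | rfl⟩
    · left
      refine mul_mem ?_ hw
      change c ^ (2 * m) ∈ _
      rw [zpow_mul]; exact zpow_mem (by exact_mod_cast hc2) _
    · right
      change c⁻¹ * (c ^ (2 * m + 1) * w) ∈ _
      have : c⁻¹ * (c ^ (2 * m + 1) * w) = (c ^ (2 : ℤ)) ^ m * w := by group
      rw [this]
      exact mul_mem (zpow_mem (by exact_mod_cast hc2) _) hw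
  have hcx : ∀ l g : G, (∀ x ∈ ({a, b} : Set G), x = l ∨ x = g) → c ∉ zpowers l ⊔ NN G := by
    intro l g hlg hcl
    apply hmeta
    have hle : _root_.commutator G ≤ zpowers l ⊔ NN G :=
      hG1.trans (sup_le (zpowers_le.2 hcl) le_sup_right)
    refine ⟨l, g, normal_of_ge _ hle, ?_⟩
    rw [← top_le_iff, ← hgen, closure_le]
    intro x hx
    rcases hlg x hx with rfl | rfl
    · exact mem_sup_right (mem_sup_left (mem_zpowers _))
    · exact mem_sup_left (mem_zpowers _)
  have hca : c ∉ zpowers a ⊔ NN G := hcx a b (by simp)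
  have hcb : c ∉ zpowers b ⊔ NN G := hcx b a (by simp)
  have hcN : c ∉ NN G := fun h => hca (mem_sup_right h)
  have hpow : ∀ (l : G) (n : ℕ), c ∉ zpowers l ⊔ NN G → l ^ n ∈ _root_.commutator G →
      l ^ n ∈ NN G := by
    intro l n h1 h2
    refine (hsplit _ h2).resolve_right (fun h3 => h1 ?_)
    have : c = l ^ n * (c⁻¹ * l ^ n)⁻¹ := by group
    rw [this]
    exact mul_mem (mem_sup_left (pow_mem (mem_zpowers l) n)) (mem_sup_right (inv_mem h3))
  have ha2 := hpow a 2 hca ha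
  have hb4 := hpow b 4 hcb hb
  have hGM : _root_.commutator G ≤ M := by
    intro x hx
    rw [hM]; exact subset_closure (Or.inr hx)
  have haM : a ∈ M := by rw [hM]; exact subset_closure (Or.inl (by simp))
  have hbM : b ^ 2 ∈ M := by rw [hM]; exact subset_closure (Or.inl (by simp))
  have hMn : M.Normal := normal_of_ge M hGM
  have hab2 : ⁅a, b ^ 2⁆ = c * (b * c * b⁻¹) := by
    rw [hc, commutatorElement_def, commutatorElement_def, pow_two]; group
  have hDN : ⁅M, M⁆ ≤ NN G := by
    have h2 : ⁅a, b ^ 2⁆ ∈ NN G := by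
      have : ⁅a, b ^ 2⁆ = c * ⁅b, c⁆ * c⁻¹ * c ^ 2 := by
        rw [hab2, commutatorElement_def b c]; group
      rw [this]
      exact mul_mem (NN_normal.conj_mem _ (comm_symm_mem _ (comm_mem_NN hcG b)) c) (sq_mem_NN hcG)
    rw [hM]
    apply lemA
    rintro x ((rfl | rfl) | hx) y ((rfl | rfl) | hy)
    · simp
    · exact h2
    · exact comm_symm_mem _ (comm_mem_NN hy _)
    · exact comm_symm_mem _ h2
    · simp
    · exact comm_symm_mem _ (comm_mem_NN hy _)
    all_goals exact comm_mem_NN hx _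
  have hDn : (⁅M, M⁆).Normal := inferInstance
  set f := QuotientGroup.mk' ⁅M, M⁆ with hf
  have hf1 : ∀ x, f x = 1 ↔ x ∈ ⁅M, M⁆ := fun x => QuotientGroup.eq_one_iff x
  have hcomm : ∀ x ∈ M, ∀ y ∈ M, Commute (f x) (f y) := by
    intro x hx y hy
    rw [← commutatorElement_eq_one_iff_commute, ← map_commutatorElement, hf1]
    exact commutator_mem_commutator hx hy
  have hND : NN G ≤ ⁅M, M⁆ := by
    have hX : closure (f '' {a, b}) = ⊤ := by
      rw [← MonoidHom.map_closure, hgen, map_top_of_surjective f (QuotientGroup.mk'_surjective _)]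
    have hfc : f c = ⁅f a, f b⁆ := map_commutatorElement f a b
    have hbc : f b * f c * (f b)⁻¹ = (f c)⁻¹ := by
      have : f (c * (b * c * b⁻¹)) = 1 := by
        rw [hf1, ← hab2]; exact commutator_mem_commutator haM hbM
      simp only [map_mul, map_inv] at this
      exact (inv_eq_of_mul_eq_one_right this).symm
    have hcM := hGM hcG
    have hcn : (zpowers (f c)).Normal := by
      apply normal_zpowers_of_gen _ _ hX
      rintro _ ⟨x, rfl | rfl, rfl⟩
      · rw [(hcomm _ haM _ hcM).eq]; simp
      · rw [hbc]; simp
    have hcc : _root_.commutator (G ⧸ ⁅M, M⁆) ≤ zpowers (f c) := by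
      apply lemA' _ _ hX
      have h0 : ⁅f a, f b⁆ ∈ zpowers (f c) := hfc ▸ mem_zpowers _
      rintro _ ⟨x, rfl | rfl, rfl⟩ _ ⟨y, rfl | rfl, rfl⟩
      · simp
      · exact h0
      · exact comm_symm_mem _ h0
      · simp
    have hNQ := lemB (f c) hcn hcc
    obtain ⟨k, hk⟩ := hNQ (NN_map f ha2)
    have hk : ((f c) ^ 2) ^ k = f a ^ 2 := by rw [← map_pow]; exact hk
    have hconj : f b * f a * (f b)⁻¹ = (f c)⁻¹ * f a := by
      rw [hfc, commutatorElement_def]; group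
    have e1 : f b * (f a) ^ 2 * (f b)⁻¹ = (f c)⁻¹ ^ 2 * f a ^ 2 := by
      rw [← conj_pow, hconj, Commute.mul_pow]
      exact (hcomm _ hcM _ haM).inv_left
    have e2 : f b * (f a) ^ 2 * (f b)⁻¹ = (((f c)⁻¹) ^ 2) ^ k := by
      rw [← hk, ← conj_zpow, ← conj_pow, hbc]
    rw [e2, ← hk] at e1
    have e3 : (f c ^ 2) ^ (2 * k - 1) = 1 := by
      have : (f c ^ 2) ^ (2 * k - 1) = ((((f c)⁻¹) ^ 2) ^ k)⁻¹ * ((f c)⁻¹ ^ 2 * (f c ^ 2) ^ k) := by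
        group
      rw [this, e1]; group
    have e4 : f c ^ 2 = 1 := by
      obtain ⟨n, hn⟩ := (isPGroup_iff_orderOf_dvd_pow.1 (hG.to_quotient ⁅M, M⁆)) (f c ^ 2)
      obtain ⟨j, _, hj⟩ := (Nat.dvd_prime_pow Nat.prime_two).1 hn
      have h5 := orderOf_dvd_iff_zpow_eq_one.2 e3
      rcases Nat.eq_zero_or_pos j with rfl | hj0
      · rw [pow_zero] at hj; exact orderOf_eq_one_iff.1 hj
      · exfalso
        have h6 : (2 : ℤ) ∣ (orderOf (f c ^ 2) : ℤ) := by
          rw [hj]; exact_mod_cast dvd_pow_self 2 hj0.ne'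
        have := h6.trans h5
        omega
    intro x hx
    rw [← hf1]
    have := hNQ (NN_map f hx)
    rw [e4] at this
    simpa using this
  refine ⟨fun h => hcN (hDN h), fun x hx => (hsplit x hx).imp (fun h => hND h) (fun h => hND h), ?_⟩
  intro x hx
  rw [hM] at hx
  suffices h : x ∈ M ∧ x ^ 2 ∈ ⁅M, M⁆ from h.2
  induction hx using closure_induction with
  | mem x hx =>
    rcases hx with (rfl | rfl) | hx
    · exact ⟨haM, hND ha2⟩
    · exact ⟨hbM, hND (by rw [← pow_mul]; exact hb4)⟩
    · exact ⟨hGM hx, hND (sq_mem_NN hx)⟩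
  | one => simp
  | mul x y hx hy h1 h2 =>
    rw [← hM] at hx hy
    refine ⟨mul_mem hx hy, ?_⟩
    rw [← hf1, map_pow, map_mul, (hcomm x hx y hy).mul_pow, ← map_pow, ← map_pow,
      (hf1 _).2 h1.2, (hf1 _).2 h2.2, one_mul]
  | inv x hx h1 =>
    rw [← hM] at hx
    refine ⟨inv_mem hx, ?_⟩
    rw [inv_pow]; exact inv_mem h1.2

lemma exists_ab [Finite G] (hG : IsPGroup 2 G)
    (htype : Nonempty ((G ⧸ _root_.commutator G) ≃* Multiplicative (ZMod 2 × ZMod 4)))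
    (M : Subgroup G) (hMmax : M.index = 2) (hGM : _root_.commutator G ≤ M)
    (hMtype : Nonempty ((↥M ⧸ (_root_.commutator G).subgroupOf M) ≃*
      Multiplicative (ZMod 2 × ZMod 2))) :
    ∃ a b : G, closure {a, b} = ⊤ ∧
      M = closure ({a, b ^ 2} ∪ (_root_.commutator G : Set G)) ∧
      a ^ 2 ∈ _root_.commutator G ∧ b ^ 4 ∈ _root_.commutator G := by
  obtain ⟨e⟩ := htype
  obtain ⟨e'⟩ := hMtype
  let f : G →* Multiplicative (ZMod 2 × ZMod 4) :=
    e.toMonoidHom.comp (QuotientGroup.mk' (_root_.commutator G))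
  have hfs : Function.Surjective f := e.surjective.comp (QuotientGroup.mk'_surjective _)
  have hf1 : ∀ x, f x = 1 ↔ x ∈ _root_.commutator G := by
    intro x
    change e (QuotientGroup.mk' _ x) = 1 ↔ _
    rw [EmbeddingLike.map_eq_one_iff]
    exact QuotientGroup.eq_one_iff x
  obtain ⟨a, ha⟩ := hfs (Multiplicative.ofAdd (1, 0))
  obtain ⟨b, hb⟩ := hfs (Multiplicative.ofAdd (0, 1))
  have hsq : ∀ x ∈ M, x ^ 2 ∈ _root_.commutator G := by
    intro x hx
    have h1 : (QuotientGroup.mk' ((_root_.commutator G).subgroupOf M) (⟨x, hx⟩ ^ 2)) = 1 := by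
      apply e'.injective
      rw [map_pow, map_pow, map_one]
      generalize e' _ = y
      revert y; decide
    have h2 := (QuotientGroup.eq_one_iff _).1 h1
    exact h2
  have hdec : ∀ x : G, ∃ i j : ℕ, ∃ u ∈ _root_.commutator G, x = a ^ i * b ^ j * u := by
    intro x
    have : ∀ y : Multiplicative (ZMod 2 × ZMod 4), ∃ i ∈ Finset.range 2, ∃ j ∈ Finset.range 4,
      y = (Multiplicative.ofAdd ((1, 0) : ZMod 2 × ZMod 4)) ^ i *
        (Multiplicative.ofAdd ((0, 1) : ZMod 2 × ZMod 4)) ^ j := by decide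
    obtain ⟨i, _, j, _, h⟩ := this (f x)
    refine ⟨i, j, (a ^ i * b ^ j)⁻¹ * x, ?_, by group⟩
    rw [← hf1, map_mul, map_inv, map_mul, map_pow, map_pow, ha, hb, h, inv_mul_cancel]
  have ha2 : a ^ 2 ∈ _root_.commutator G := by
    rw [← hf1, map_pow, ha]; decide
  have hb4 : b ^ 4 ∈ _root_.commutator G := by
    rw [← hf1, map_pow, hb]; decide
  have hbM : b ∉ M := by
    intro h
    have := hsq b h
    rw [← hf1, map_pow, hb] at this
    revert this; decide
  have habM : a * b ∉ M := by
    intro h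
    have := hsq _ h
    rw [← hf1, map_pow, map_mul, ha, hb] at this
    revert this; decide
  have haM : a ∈ M := by
    by_contra h
    exact habM ((mul_mem_iff_of_index_two hMmax).2 (by simp [h, hbM]))
  have hb2M : b ^ 2 ∈ M := sq_mem_of_index_two hMmax b
  refine ⟨a, b, ?_, ?_, ha2, hb4⟩
  · apply nongen hG
    rw [← top_le_iff]
    intro x _
    obtain ⟨i, j, u, hu, rfl⟩ := hdec x
    have h1 : a ∈ closure {a, b} := subset_closure (by simp)
    have h2 : b ∈ closure {a, b} := subset_closure (by simp)
    exact mul_mem (mem_sup_left (mul_mem (pow_mem h1 _) (pow_mem h2 _))) (mem_sup_right hu)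
  · apply le_antisymm
    · intro x hx
      obtain ⟨i, j, u, hu, rfl⟩ := hdec x
      have h1 : a ∈ closure ({a, b ^ 2} ∪ (_root_.commutator G : Set G)) := subset_closure (by simp)
      have h2 : b ^ 2 ∈ closure ({a, b ^ 2} ∪ (_root_.commutator G : Set G)) :=
        subset_closure (by simp)
      have h3 : u ∈ closure ({a, b ^ 2} ∪ (_root_.commutator G : Set G)) :=
        subset_closure (Or.inr hu)
      rcases Nat.even_or_odd' j with ⟨m, rfl | rfl⟩
      · rw [pow_mul]
        exact mul_mem (mul_mem (pow_mem h1 _) (pow_mem h2 _)) h3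
      · exfalso
        apply hbM
        have h4 : b ^ (2 * m + 1) ∈ M := by
          rwa [mul_mem_cancel_right (hGM hu), mul_mem_cancel_left (pow_mem haM i)] at hx
        rw [pow_succ, pow_mul] at h4
        rwa [mul_mem_cancel_left (pow_mem hb2M m)] at h4
    · rw [closure_le]
      rintro x ((rfl | rfl) | hx)
      · exact haM
      · exact hb2M
      · exact hGM hx

lemma meta_two_gen (h : IsMetacyclic G) (M : Subgroup G) :
    ∃ S : Finset M, S.card ≤ 2 ∧ closure (S : Set M) = ⊤ := by
  classical
  obtain ⟨N, hN, hc, hq⟩ := h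
  have hc1 : IsCyclic (N.subgroupOf M) := by
    let φ : N.subgroupOf M →* N := (M.subtype.comp (N.subgroupOf M).subtype).codRestrict N
      (fun x => x.2)
    refine isCyclic_of_injective φ ?_
    intro x y hxy
    exact Subtype.ext (Subtype.ext (congrArg (fun z : N => (z : G)) hxy))
  let ψ : M →* G ⧸ N := (QuotientGroup.mk' N).comp M.subtype
  obtain ⟨⟨v, hv⟩⟩ := (inferInstance : IsCyclic ψ.range)
  obtain ⟨⟨u, hu⟩⟩ := hc1
  obtain ⟨v', hv'⟩ := v.2
  refine ⟨{u.1, v'}, Finset.card_le_two, ?_⟩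
  rw [← top_le_iff]
  intro x _
  have h1 : u.1 ∈ closure (({u.1, v'} : Finset M) : Set M) := subset_closure (by simp)
  have h2 : v' ∈ closure (({u.1, v'} : Finset M) : Set M) := subset_closure (by simp)
  obtain ⟨i, hi⟩ := hv ⟨ψ x, ⟨x, rfl⟩⟩
  have hi : (v : G ⧸ N) ^ i = ψ x := congrArg (Subtype.val) hi
  rw [← hv', ← map_zpow] at hi
  have hw : (v' ^ i)⁻¹ * x ∈ N.subgroupOf M := by
    rw [mem_subgroupOf]
    rw [← QuotientGroup.eq_one_iff]
    change ψ ((v' ^ i)⁻¹ * x) = 1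
    rw [map_mul, map_inv, hi, inv_mul_cancel]
  obtain ⟨j, hj⟩ := hu ⟨_, hw⟩
  have hj : (u : M) ^ j = (v' ^ i)⁻¹ * x := congrArg Subtype.val hj
  have : x = v' ^ i * (u : M) ^ j := by rw [hj]; group
  rw [this]
  exact mul_mem (zpow_mem h2 _) (zpow_mem h1 _)

lemma iso_of_card {A : Type*} [CommGroup A] [Finite A] (h2 : ∀ x : A, x ^ 2 = 1)
    (hcard : Nat.card A = 8) :
    Nonempty (A ≃* Multiplicative (ZMod 2 × ZMod 2 × ZMod 2)) := by
  have : Fact (Nat.Prime 2) := ⟨Nat.prime_two⟩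
  letI : Module (ZMod 2) (Additive A) := AddCommGroup.zmodModule (n := 2) (fun x => h2 x.toMul)
  have : Finite (Additive A) := inferInstanceAs (Finite A)
  have hfin : Module.Finite (ZMod 2) (Additive A) := Module.Finite.of_finite
  have h3 : Module.finrank (ZMod 2) (Additive A) = 3 := by
    have h := Module.natCard_eq_pow_finrank (K := ZMod 2) (V := Additive A)
    rw [Nat.card_zmod] at h
    have h8 : Nat.card (Additive A) = 2 ^ 3 := hcard
    rw [h8] at h
    exact (Nat.pow_right_injective le_rfl h).symm
  have h4 : Module.finrank (ZMod 2) (ZMod 2 × ZMod 2 × ZMod 2) = 3 := by simp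
  let e : Additive A ≃ₗ[ZMod 2] (ZMod 2 × ZMod 2 × ZMod 2) :=
    LinearEquiv.ofFinrankEq _ _ (h3.trans h4.symm)
  exact ⟨AddEquiv.toMultiplicativeRight e.toAddEquiv⟩

lemma two_imp_three {M : Type*} [Group M] [Finite M] (hM : IsPGroup 2 M)
    (h : Nonempty ((M ⧸ _root_.commutator M) ≃* Multiplicative (ZMod 2 × ZMod 2 × ZMod 2))) :
    (∃ S : Finset M, S.card = 3 ∧ closure (S : Set M) = ⊤) ∧
        ∀ S : Finset M, closure (S : Set M) = ⊤ → 3 ≤ S.card := by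
  classical
  obtain ⟨e⟩ := h
  let f : M →* Multiplicative (ZMod 2 × ZMod 2 × ZMod 2) :=
    e.toMonoidHom.comp (QuotientGroup.mk' (_root_.commutator M))
  have hfs : Function.Surjective f := e.surjective.comp (QuotientGroup.mk'_surjective _)
  have hf1 : ∀ x, f x = 1 ↔ x ∈ _root_.commutator M := by
    intro x
    change e (QuotientGroup.mk' _ x) = 1 ↔ _
    rw [EmbeddingLike.map_eq_one_iff]
    exact QuotientGroup.eq_one_iff x
  constructor
  · obtain ⟨a, ha⟩ := hfs (Multiplicative.ofAdd (1, 0, 0))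
    obtain ⟨b, hb⟩ := hfs (Multiplicative.ofAdd (0, 1, 0))
    obtain ⟨c, hc⟩ := hfs (Multiplicative.ofAdd (0, 0, 1))
    refine ⟨{a, b, c}, ?_, ?_⟩
    · rw [Finset.card_eq_three]
      refine ⟨a, b, c, ?_, ?_, ?_, rfl⟩
      · rintro rfl; rw [ha] at hb; revert hb; decide
      · rintro rfl; rw [ha] at hc; revert hc; decide
      · rintro rfl; rw [hb] at hc; revert hc; decide
    · apply nongen hM
      rw [← top_le_iff]
      intro x _
      have : ∀ y : Multiplicative (ZMod 2 × ZMod 2 × ZMod 2), ∃ i ∈ Finset.range 2,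
        ∃ j ∈ Finset.range 2, ∃ k ∈ Finset.range 2,
        y = (Multiplicative.ofAdd ((1, 0, 0) : ZMod 2 × ZMod 2 × ZMod 2)) ^ i *
          (Multiplicative.ofAdd ((0, 1, 0) : ZMod 2 × ZMod 2 × ZMod 2)) ^ j *
          (Multiplicative.ofAdd ((0, 0, 1) : ZMod 2 × ZMod 2 × ZMod 2)) ^ k := by decide
      obtain ⟨i, _, j, _, k, _, h⟩ := this (f x)
      have hu : (a ^ i * b ^ j * c ^ k)⁻¹ * x ∈ _root_.commutator M := by
        rw [← hf1, map_mul, map_inv, map_mul, map_mul, map_pow, map_pow, map_pow, ha, hb, hc, h,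
          inv_mul_cancel]
      have hx : x = (a ^ i * b ^ j * c ^ k) * ((a ^ i * b ^ j * c ^ k)⁻¹ * x) := by group
      rw [hx]
      have h1 : a ∈ closure (({a, b, c} : Finset M) : Set M) := subset_closure (by simp)
      have h2 : b ∈ closure (({a, b, c} : Finset M) : Set M) := subset_closure (by simp)
      have h3 : c ∈ closure (({a, b, c} : Finset M) : Set M) := subset_closure (by simp)
      exact mul_mem (mem_sup_left (mul_mem (mul_mem (pow_mem h1 _) (pow_mem h2 _)) (pow_mem h3 _)))
        (mem_sup_right hu)
  · intro S hS
    let T : Finset (ZMod 2 × ZMod 2 × ZMod 2) := S.image (fun x => (f x).toAdd)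
    have hT : Submodule.span (ZMod 2) (T : Set (ZMod 2 × ZMod 2 × ZMod 2)) = ⊤ := by
      rw [← top_le_iff]
      intro y _
      obtain ⟨x, hx⟩ := hfs (Multiplicative.ofAdd y)
      have hle : closure (S : Set M) ≤ (AddSubgroup.toSubgroup
          (Submodule.span (ZMod 2) (T : Set (ZMod 2 × ZMod 2 × ZMod 2))).toAddSubgroup).comap f := by
        rw [closure_le]
        intro s hs
        apply Submodule.subset_span
        exact Finset.mem_coe.2 (Finset.mem_image_of_mem _ hs)
      have := hle (hS ▸ mem_top x)
      rw [mem_comap, hx] at this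
      exact this
    have h4 : Module.finrank (ZMod 2) (ZMod 2 × ZMod 2 × ZMod 2) = 3 := by simp
    have h5 := finrank_span_finset_le_card (R := ZMod 2) T
    rw [Set.finrank, hT, finrank_top, h4] at h5
    exact h5.trans Finset.card_image_le

lemma one_imp_two [Finite G] (hG : IsPGroup 2 G)
    (htype : Nonempty ((G ⧸ _root_.commutator G) ≃* Multiplicative (ZMod 2 × ZMod 4)))
    (M : Subgroup G) (hMmax : M.index = 2) (hGM : _root_.commutator G ≤ M)
    (hMtype : Nonempty ((↥M ⧸ (_root_.commutator G).subgroupOf M) ≃*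
      Multiplicative (ZMod 2 × ZMod 2))) (hm : ¬ IsMetacyclic G) :
    Nonempty ((↥M ⧸ _root_.commutator ↥M) ≃* Multiplicative (ZMod 2 × ZMod 2 × ZMod 2)) := by
  obtain ⟨a, b, hgen, hM, ha, hb⟩ := exists_ab hG htype M hMmax hGM hMtype
  obtain ⟨h1, h2, h3⟩ := mainA hG a b hgen M hM ha hb (fun h => hm (metaMod_lift hG h))
  have hcG : ⁅a, b⁆ ∈ _root_.commutator G := commutator_mem_commutator (mem_top _) (mem_top _)
  have hDG : ⁅M, M⁆ ≤ _root_.commutator G := commutator_mono le_top le_top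
  have hD : ⁅M, M⁆.subgroupOf M = _root_.commutator M := by
    rw [← map_subtype_commutator, subgroupOf, comap_map_eq_self_of_injective M.subtype_injective]
  have r1 : ⁅M, M⁆.relIndex (_root_.commutator G) = 2 := by
    rw [relIndex, index_eq_two_iff]
    refine ⟨⟨⁅a, b⁆⁻¹, inv_mem hcG⟩, ?_⟩
    rintro ⟨x, hx⟩
    simp only [mem_subgroupOf, Subgroup.coe_mul]
    have hn : (⁅M, M⁆).Normal := by
      have : M.Normal := normal_of_ge M hGM
      infer_instance
    rw [hn.mem_comm_iff]
    by_cases hxD : x ∈ ⁅M, M⁆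
    · right
      refine ⟨hxD, fun h => h1 ?_⟩
      rw [mul_mem_cancel_right hxD] at h
      exact inv_mem_iff.1 h
    · left
      exact ⟨(h2 x hx).resolve_left hxD, hxD⟩
  have r2 : (_root_.commutator G).relIndex M = 4 := by
    obtain ⟨e⟩ := hMtype
    rw [relIndex, index, Nat.card_congr e.toEquiv]
    simp
  have hcard : Nat.card (M ⧸ _root_.commutator M) = 8 := by
    have := relIndex_mul_relIndex ⁅M, M⁆ (_root_.commutator G) M hDG hGM
    rw [r1, r2, relIndex, hD] at this
    exact this.symm
  letI : CommGroup (M ⧸ _root_.commutator M) := inferInstanceAs (CommGroup (Abelianization M))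
  refine iso_of_card (A := Abelianization M) ?_ hcard
  intro x
  obtain ⟨x, rfl⟩ := QuotientGroup.mk'_surjective _ x
  change QuotientGroup.mk' (_root_.commutator M) (x ^ 2) = 1
  refine (QuotientGroup.eq_one_iff _).2 ?_
  rw [← hD, mem_subgroupOf]
  exact h3 x x.2

end

/-- Let `G` be a metabelian finite 2-group with `G/G'` of type `(2,4)`, and `M`
the maximal subgroup of `G` with `M/G'` of type `(2,2)`. TFAE:
(1) `G` is not metacyclic; (2) `M/M' ≅ ℤ/2 × ℤ/2 × ℤ/2`;
(3) the minimal number of generators of `M` is 3. -/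
theorem not_metacyclic_iff_maximal_subgroup
    {G : Type*} [Group G] [Finite G] (hG : IsPGroup 2 G)
    (hmetab : ∀ x ∈ commutator G, ∀ y ∈ commutator G, Commute x y)
    (htype : Nonempty ((G ⧸ commutator G) ≃* Multiplicative (ZMod 2 × ZMod 4)))
    (M : Subgroup G) (hMmax : M.index = 2) (hGM : commutator G ≤ M)
    (hMtype : Nonempty ((↥M ⧸ (commutator G).subgroupOf M) ≃*
      Multiplicative (ZMod 2 × ZMod 2))) :
    (¬ IsMetacyclic G ↔
      Nonempty ((↥M ⧸ commutator ↥M) ≃* Multiplicative (ZMod 2 × ZMod 2 × ZMod 2))) ∧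
    (¬ IsMetacyclic G ↔
      ((∃ S : Finset ↥M, S.card = 3 ∧ Subgroup.closure (S : Set ↥M) = ⊤) ∧
        ∀ S : Finset ↥M, Subgroup.closure (S : Set ↥M) = ⊤ → 3 ≤ S.card)) := by
  have h12 := one_imp_two hG htype M hMmax hGM hMtype
  have h23 := two_imp_three (hG.to_subgroup M)
  have h31 : ((∃ S : Finset ↥M, S.card = 3 ∧ Subgroup.closure (S : Set ↥M) = ⊤) ∧
        ∀ S : Finset ↥M, Subgroup.closure (S : Set ↥M) = ⊤ → 3 ≤ S.card) → ¬ IsMetacyclic G := by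
    rintro ⟨_, h⟩ hm
    obtain ⟨S, hS, hS'⟩ := meta_two_gen hm M
    have := h S hS'
    omega
  exact ⟨⟨h12, fun h => h31 (h23 h)⟩, ⟨fun h => h23 (h12 h), h31⟩⟩
end

section
/- Let G be a nonabelian 2-group with G/G' of type (2,4), and M the maximal subgroup of G with M/G' of type (2,2). Then the following are equivalent: (1) G is metacyclic; (2) M/M' is of type (2, 2^m) for some m ≥ 2; (3) d(M) = 2. -/
open scoped commutatorElement

theorem aux_coatom {P : Type*} [Group P] [Finite P] (hP : IsPGroup 2 P) {H : Subgroup P}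
    (hH : IsCoatom H) : H.Normal ∧ ∀ g : P, g ^ 2 ∈ H := by
  have : Fact (Nat.Prime 2) := ⟨Nat.prime_two⟩
  have : Group.IsNilpotent P := hP.isNilpotent
  have hn : H.Normal := Subgroup.NormalizerCondition.normal_of_coatom H Group.normalizerCondition_of_isNilpotent hH
  refine ⟨hn, fun g => ?_⟩
  by_contra hg
  have h1 : H ⊔ Subgroup.zpowers (g ^ 2) = ⊤ := by
    apply hH.2
    refine lt_of_le_of_ne le_sup_left ?_
    intro h
    apply hg
    rw [h]
    exact Subgroup.mem_sup_right (Subgroup.mem_zpowers _)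
  have h2 : g ∈ H ⊔ Subgroup.zpowers (g ^ 2) := by rw [h1]; trivial
  rw [Subgroup.mem_sup_of_normal_left] at h2
  obtain ⟨a, ha, b, hb, hab⟩ := h2
  obtain ⟨k, rfl⟩ := Subgroup.mem_zpowers_iff.1 hb
  have h3 : g ^ (1 - 2 * k) ∈ H := by
    have : g ^ (1 - 2 * k) = a := by
      rw [zpow_sub, zpow_one, zpow_mul, mul_inv_eq_iff_eq_mul]
      exact_mod_cast hab.symm
    rwa [this]
  obtain ⟨n, hn2⟩ := hP g
  have hcop : IsCoprime (1 - 2 * k : ℤ) ((2 : ℤ) ^ n) := by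
    apply IsCoprime.pow_right
    exact ⟨1, k, by ring⟩
  obtain ⟨u, v, huv⟩ := hcop
  apply hg
  have : g ∈ H := by
    have e : g = (g ^ (1 - 2 * k)) ^ u * (g ^ ((2 : ℤ) ^ n)) ^ v := by
      rw [← zpow_mul, ← zpow_mul, ← zpow_add, mul_comm _ u, mul_comm _ v, huv, zpow_one]
    have e2 : g ^ ((2 : ℤ) ^ n) = 1 := by
      have : ((2 : ℤ) ^ n) = ((2 ^ n : ℕ) : ℤ) := by push_cast; rfl
      rw [this, zpow_natCast, hn2]
    rw [e2, one_zpow, mul_one] at e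
    rw [e]
    exact H.zpow_mem h3 u
  exact H.pow_mem this 2

theorem aux_comm_le {P : Type*} [Group P] {H : Subgroup P} [H.Normal] (h : ∀ g : P, g ^ 2 ∈ H) :
    commutator P ≤ H := by
  rw [← Subgroup.Normal.quotient_commutative_iff_commutator_le]
  have hsq : ∀ a : P ⧸ H, a * a = 1 := by
    intro a
    obtain ⟨a, rfl⟩ := QuotientGroup.mk_surjective a
    rw [← QuotientGroup.mk_mul, QuotientGroup.eq_one_iff, ← pow_two]
    exact h a
  refine ⟨⟨fun a b => ?_⟩⟩
  have h1 : ∀ a : P ⧸ H, a⁻¹ = a := fun a => inv_eq_of_mul_eq_one_left (hsq a)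
  rw [← h1 (a * b), mul_inv_rev, h1, h1]

theorem aux_sq_frattini {P : Type*} [Group P] [Finite P] (hP : IsPGroup 2 P) (g : P) :
    g ^ 2 ∈ frattini P := by
  simp only [frattini, Order.radical, Subgroup.mem_iInf]
  intro H hH
  exact (aux_coatom hP hH).2 g

theorem aux_gen {P : Type*} [Group P] [Finite P] (hP : IsPGroup 2 P) {K : Subgroup P}
    (h : K ⊔ commutator P = ⊤) : K = ⊤ := by
  apply frattini_nongenerating
  rw [eq_top_iff, ← h]
  exact sup_le_sup_left (aux_comm_le (aux_sq_frattini hP)) _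

/-- `L` is a normal subgroup properly inside `G'` with `G'/L` central of exponent two. -/
def GoodSub {G : Type*} [Group G] (L : Subgroup G) : Prop :=
  L.Normal ∧ L < commutator G ∧ (∀ h ∈ commutator G, ∀ g, h * g * h⁻¹ * g⁻¹ ∈ L) ∧
    ∀ h ∈ commutator G, h ^ 2 ∈ L

theorem aux_center {Q : Type*} [Group Q] [Finite Q] (hQ : IsPGroup 2 Q) (D : Subgroup Q)
    [D.Normal] (hD : D ≠ ⊥) : ∃ w ∈ D, w ≠ 1 ∧ w ^ 2 = 1 ∧ ∀ g, g * w = w * g := by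
  have : Fact (Nat.Prime 2) := ⟨Nat.prime_two⟩
  have : Nontrivial D := (Subgroup.nontrivial_iff_ne_bot D).2 hD
  have dvd : 2 ∣ Nat.card D := by
    obtain ⟨n, hn0, hn⟩ := (hQ.to_subgroup D).nontrivial_iff_card.mp inferInstance
    exact hn.symm ▸ dvd_pow_self _ (ne_of_gt hn0)
  obtain ⟨z, hz, hz1⟩ := (hQ.of_equiv ConjAct.toConjAct).exists_fixed_point_of_prime_dvd_card_of_fixed_point
    D dvd (a := 1) (by intro g; simp)
  have hzc : ∀ g : Q, g * z = z * g := by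
    intro g
    have := congrArg Subtype.val (hz (ConjAct.toConjAct g))
    rw [ConjAct.Subgroup.val_conj_smul, ConjAct.toConjAct_smul] at this
    rw [← mul_inv_eq_iff_eq_mul]
    exact this
  have hz2 : (z : Q) ≠ 1 := fun h => hz1 (Subtype.ext h.symm)
  obtain ⟨n, hn⟩ := hQ (z : Q)
  classical
  have hex : ∃ n, (z : Q) ^ 2 ^ n = 1 := ⟨n, hn⟩
  have hpos : Nat.find hex ≠ 0 := by
    intro h0
    have := Nat.find_spec hex
    rw [h0] at this
    simp at this
    exact hz1 this.symm
  obtain ⟨k, hk⟩ := Nat.exists_eq_succ_of_ne_zero hpos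
  refine ⟨(z : Q) ^ 2 ^ k, D.pow_mem z.2 _, Nat.find_min hex (by omega), ?_, ?_⟩
  · rw [← pow_mul, ← pow_succ]
    have := Nat.find_spec hex
    rwa [hk] at this
  · intro g
    exact ((show Commute g z from hzc g).pow_right _)

theorem aux_exists_good {G : Type*} [Group G] [Finite G] (hG : IsPGroup 2 G) (A : Subgroup G)
    [A.Normal] (hA : A < commutator G) : ∃ L, A ≤ L ∧ GoodSub L := by
  obtain ⟨L, hAL, hL⟩ := Finite.exists_le_maximal (p := fun L : Subgroup G => L.Normal ∧ L < commutator G)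
    (a := A) ⟨inferInstance, hA⟩
  obtain ⟨⟨hLn, hLlt⟩, hmax⟩ := hL
  refine ⟨L, hAL, hLn, hLlt, ?_⟩
  let f := QuotientGroup.mk' L
  have hfs : Function.Surjective f := QuotientGroup.mk'_surjective L
  have : ((commutator G).map f).Normal := Subgroup.Normal.map inferInstance f hfs
  obtain ⟨w, hwD, hw1, hw2, hwc⟩ := aux_center (hG.to_quotient L) ((commutator G).map f) (by
    intro h
    rw [Subgroup.map_eq_bot_iff, QuotientGroup.ker_mk'] at h
    exact absurd (hLlt.trans_le h) (lt_irrefl _))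
  obtain ⟨v, hv, hvw⟩ := hwD
  have hzn : (Subgroup.zpowers w).Normal := by
    constructor
    intro a ha g
    obtain ⟨k, rfl⟩ := Subgroup.mem_zpowers_iff.1 ha
    have : g * w ^ k = w ^ k * g := (show Commute g w from hwc g).zpow_right k
    rw [this, mul_inv_cancel_right]
    exact ha
  have hK : commutator G ≤ (Subgroup.zpowers w).comap f := by
    by_contra hcon
    have hLK : L ≤ (Subgroup.zpowers w).comap f ⊓ commutator G := by
      refine le_inf ?_ hLlt.le
      intro l hl
      rw [Subgroup.mem_comap]
      have : f l = 1 := (QuotientGroup.eq_one_iff l).2 hl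
      rw [this]; exact one_mem _
    have := hmax (y := (Subgroup.zpowers w).comap f ⊓ commutator G) ⟨inferInstance, ?_⟩ hLK
    · apply hw1
      rw [← hvw]
      apply (QuotientGroup.eq_one_iff v).2
      apply this
      refine ⟨?_, hv⟩
      change f v ∈ Subgroup.zpowers w
      rw [hvw]
      exact Subgroup.mem_zpowers w
    · refine lt_of_le_of_ne inf_le_right ?_
      intro h
      exact hcon (inf_eq_right.1 h)
  constructor
  · intro h hh g
    obtain ⟨k, hk⟩ := Subgroup.mem_zpowers_iff.1 (hK hh)
    apply (QuotientGroup.eq_one_iff _).1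
    change f (h * g * h⁻¹ * g⁻¹) = 1
    have : f g * w ^ k = w ^ k * f g := (show Commute (f g) w from hwc _).zpow_right k
    simp only [map_mul, map_inv, ← hk]
    rw [← this]; group
  · intro h hh
    obtain ⟨k, hk⟩ := Subgroup.mem_zpowers_iff.1 (hK hh)
    apply (QuotientGroup.eq_one_iff _).1
    change f (h ^ 2) = 1
    rw [map_pow, ← hk, ← zpow_natCast, ← zpow_mul, mul_comm, zpow_mul, zpow_natCast, hw2, one_zpow]

theorem aux_comm_le_of_gen {G : Type*} [Group G] {x y : G} (hxy : Subgroup.closure {x, y} = ⊤)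
    (H : Subgroup G) [H.Normal] (hc : ⁅x, y⁆ ∈ H) : commutator G ≤ H := by
  have hcom : Commute (x : G ⧸ H) (y : G ⧸ H) := by
    have := (QuotientGroup.eq_one_iff (N := H) ⁅x, y⁆).2 hc
    rw [commutatorElement_def] at this
    simp only [QuotientGroup.mk_mul, QuotientGroup.mk_inv] at this
    rw [mul_inv_eq_one, mul_inv_eq_iff_eq_mul] at this
    exact this
  have key : ∀ q : G ⧸ H, Commute q x → Commute q y → ∀ g : G, Commute q g := by
    intro q h1 h2 g
    have : g ∈ Subgroup.closure {x, y} := by rw [hxy]; trivial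
    induction this using Subgroup.closure_induction with
    | mem z hz =>
      rcases hz with rfl | rfl
      · exact h1
      · exact h2
    | one => exact Commute.one_right q
    | mul a b _ _ ha hb => exact ha.mul_right hb
    | inv a _ ha => exact ha.inv_right
  rw [← Subgroup.Normal.quotient_commutative_iff_commutator_le]
  refine ⟨⟨fun a b => ?_⟩⟩
  obtain ⟨a, rfl⟩ := QuotientGroup.mk_surjective a
  obtain ⟨b, rfl⟩ := QuotientGroup.mk_surjective b
  exact key a (key x (Commute.refl _) hcom a).symm (key y hcom.symm (Commute.refl _) a).symm b

theorem aux_two {G : Type*} [Group G] {x y : G} (hxy : Subgroup.closure {x, y} = ⊤)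
    (L : Subgroup G) [L.Normal] (h1 : ∀ g, ⁅x, y⁆ * g * ⁅x, y⁆⁻¹ * g⁻¹ ∈ L) (h2 : ⁅x, y⁆ ^ 2 ∈ L)
    (h : G) (hh : h ∈ commutator G) : h ∈ L ∨ h * ⁅x, y⁆⁻¹ ∈ L := by
  let f := QuotientGroup.mk' L
  have hfs : Function.Surjective f := QuotientGroup.mk'_surjective L
  have hker : ∀ g, f g = 1 ↔ g ∈ L := fun g => QuotientGroup.eq_one_iff g
  set w := f ⁅x, y⁆ with hw
  have hwc : ∀ q, Commute q w := by
    intro q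
    obtain ⟨g, rfl⟩ := hfs q
    have := (hker _).2 (h1 g)
    simp only [map_mul, map_inv] at this
    rw [mul_inv_eq_one, mul_inv_eq_iff_eq_mul] at this
    exact this.symm
  have hw2 : w ^ 2 = 1 := by rw [hw, ← map_pow]; exact (hker _).2 h2
  have hzn : (Subgroup.zpowers w).Normal := by
    constructor
    intro a ha g
    obtain ⟨k, rfl⟩ := Subgroup.mem_zpowers_iff.1 ha
    have : g * w ^ k = w ^ k * g := (hwc g).zpow_right k
    rw [this, mul_inv_cancel_right]
    exact ha
  have hle : commutator G ≤ (Subgroup.zpowers w).comap f :=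
    aux_comm_le_of_gen hxy _ (Subgroup.mem_zpowers w)
  obtain ⟨k, hk⟩ := Subgroup.mem_zpowers_iff.1 (hle hh)
  have hw2' : w ^ (2 : ℤ) = 1 := by exact_mod_cast hw2
  rcases Int.even_or_odd' k with ⟨j, rfl | rfl⟩
  · left
    rw [← hker, ← hk, zpow_mul, hw2', one_zpow]
  · right
    rw [← hker, map_mul, map_inv, ← hw, ← hk, zpow_add, zpow_mul, hw2', one_zpow]
    simp

theorem aux_unique {G : Type*} [Group G] {x y : G} (hxy : Subgroup.closure {x, y} = ⊤)
    {L₁ L₂ : Subgroup G} (h₁ : GoodSub L₁) (h₂ : GoodSub L₂) : L₁ ≤ L₂ := by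
  obtain ⟨n1, lt1, c1, s1⟩ := h₁
  obtain ⟨n2, lt2, c2, s2⟩ := h₂
  have hc : ⁅x, y⁆ ∈ commutator G := Subgroup.commutator_mem_commutator trivial trivial
  intro h hh
  rcases aux_two hxy (L₁ ⊓ L₂) (fun g => ⟨c1 _ hc g, c2 _ hc g⟩) ⟨s1 _ hc, s2 _ hc⟩ h (lt1.le hh)
    with h3 | h3
  · exact h3.2
  · exfalso
    have : ⁅x, y⁆ ∈ L₁ := by
      have := L₁.mul_mem (L₁.inv_mem h3.1) hh
      simpa using this
    exact absurd (lt1.trans_le (aux_comm_le_of_gen hxy L₁ this)) (lt_irrefl _)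

theorem aux_mod {G : Type*} [Group G] {x y : G} {L : Subgroup G} (hL : GoodSub L)
    {M : Subgroup G}
    (hM : ∀ m ∈ M, ∃ i j : ℕ, ∃ g ∈ commutator G, m = x ^ i * (y ^ 2) ^ j * g) :
    (∀ m ∈ M, ∀ n ∈ M, ⁅m, n⁆ ∈ L) ∧ (x ^ 2 ∈ L → y ^ 4 ∈ L → ∀ m ∈ M, m ^ 2 ∈ L) := by
  obtain ⟨nL, lt, hcen, hsq⟩ := hL
  let f := QuotientGroup.mk' L
  have hfs : Function.Surjective f := QuotientGroup.mk'_surjective L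
  have hker : ∀ g, f g = 1 ↔ g ∈ L := fun g => QuotientGroup.eq_one_iff g
  have hC : ∀ h ∈ commutator G, ∀ q, Commute (f h) q := by
    intro h hh q
    obtain ⟨g, rfl⟩ := hfs q
    have := (hker _).2 (hcen h hh g)
    simp only [map_mul, map_inv] at this
    rw [mul_inv_eq_one, mul_inv_eq_iff_eq_mul] at this
    exact this
  have hc : ⁅x, y⁆ ∈ commutator G := Subgroup.commutator_mem_commutator trivial trivial
  have hXY : Commute (f x) (f (y ^ 2)) := by
    have h1 : f x * f y = f ⁅x, y⁆ * (f y * f x) := by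
      rw [commutatorElement_def]; simp only [map_mul, map_inv]; group
    have h2 : f ⁅x, y⁆ * f ⁅x, y⁆ = 1 := by
      rw [← map_mul, ← pow_two, hker]; exact hsq _ hc
    have h3 := (hC _ hc (f y)).eq
    change f x * f (y ^ 2) = f (y ^ 2) * f x
    rw [map_pow, pow_two, ← mul_assoc, h1, mul_assoc, mul_assoc, h1, ← mul_assoc (f y) (f ⁅x, y⁆), ← h3]
    rw [mul_assoc, ← mul_assoc, h2, one_mul, mul_assoc]
  constructor
  · intro m hm n hn
    obtain ⟨i, j, g, hg, rfl⟩ := hM m hm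
    obtain ⟨i', j', g', hg', rfl⟩ := hM n hn
    rw [← hker, map_commutatorElement, commutatorElement_eq_one_iff_commute]
    simp only [map_mul, map_pow _ x, map_pow f (y ^ 2)]
    have a1 : Commute (f x ^ i) (f x ^ i' * f (y ^ 2) ^ j' * f g') :=
      (((Commute.refl _).pow_pow i i').mul_right (hXY.pow_pow i j')).mul_right (hC _ hg' _).symm
    have a2 : Commute (f (y ^ 2) ^ j) (f x ^ i' * f (y ^ 2) ^ j' * f g') :=
      ((hXY.symm.pow_pow j i').mul_right ((Commute.refl _).pow_pow j j')).mul_right (hC _ hg' _).symm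
    exact (a1.mul_left a2).mul_left (hC _ hg _)
  · intro hx hy m hm
    obtain ⟨i, j, g, hg, rfl⟩ := hM m hm
    have hx' : f x ^ 2 = 1 := by rw [← map_pow, hker]; exact hx
    have hy' : f (y ^ 2) ^ 2 = 1 := by rw [← map_pow, hker, ← pow_mul]; exact hy
    have hg' : f g ^ 2 = 1 := by rw [← map_pow, hker]; exact hsq _ hg
    rw [← hker, map_pow]
    simp only [map_mul, map_pow _ x, map_pow f (y ^ 2)]
    rw [(hC _ hg _).symm.mul_pow, (hXY.pow_pow i j).mul_pow, ← pow_mul, ← pow_mul, mul_comm i,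
      mul_comm j, pow_mul, pow_mul, hx', hy', hg']
    simp

theorem aux_meta {G : Type*} [Group G] [Finite G] (hG : IsPGroup 2 G) {u w v : G}
    (huw : Subgroup.closure {u, w} = ⊤) (hv : v ∈ Subgroup.zpowers u)
    (hn : commutator G ≤ Subgroup.normalClosure {v ^ 2}) : IsMetacyclic G := by
  have hcN : commutator G ≤ Subgroup.zpowers u ⊔ commutator G := le_sup_right
  set N := Subgroup.zpowers u ⊔ commutator G with hNdef
  have hN : N.Normal := Subgroup.Normal.of_commutator_le _ hcN
  have huN : u ∈ N := Subgroup.mem_sup_left (Subgroup.mem_zpowers u)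
  have hvN : v ∈ N := Subgroup.mem_sup_left hv
  have hGF : commutator G ≤ (frattini N).map N.subtype := by
    refine hn.trans (Subgroup.normalClosure_le_normal ?_)
    intro z hz
    rw [Set.mem_singleton_iff.1 hz]
    exact ⟨⟨v, hvN⟩ ^ 2, aux_sq_frattini (hG.to_subgroup N) _, rfl⟩
  refine ⟨N, hN, ?_, ?_⟩
  · have : Subgroup.zpowers (⟨u, huN⟩ : N) = ⊤ := by
      apply frattini_nongenerating
      rw [eq_top_iff]
      rintro ⟨n, hnN⟩ -
      have h2 : n ∈ Subgroup.zpowers u ⊔ commutator G := hnN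
      rw [Subgroup.mem_sup_of_normal_right] at h2
      obtain ⟨a, ha, b, hb, hab⟩ := h2
      obtain ⟨k, rfl⟩ := Subgroup.mem_zpowers_iff.1 ha
      obtain ⟨b', hb', rfl⟩ := hGF hb
      have : (⟨n, hnN⟩ : N) = (⟨u, huN⟩ : N) ^ k * b' := by
        apply Subtype.ext
        exact hab.symm
      rw [this]
      exact mul_mem (Subgroup.mem_sup_left (Subgroup.zpow_mem_zpowers _ k)) (Subgroup.mem_sup_right hb')
    exact ⟨⟨⟨u, huN⟩, fun z => by
      have : z ∈ Subgroup.zpowers (⟨u, huN⟩ : N) := by rw [this]; trivial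
      exact this⟩⟩
  · refine ⟨⟨(w : G ⧸ N), fun q => ?_⟩⟩
    obtain ⟨g, rfl⟩ := QuotientGroup.mk_surjective q
    have : g ∈ Subgroup.closure {u, w} := by rw [huw]; trivial
    change (g : G ⧸ N) ∈ Subgroup.zpowers (w : G ⧸ N)
    induction this using Subgroup.closure_induction with
    | mem z hz =>
      rcases hz with rfl | rfl
      · rw [(QuotientGroup.eq_one_iff z).2 huN]; exact one_mem _
      · exact Subgroup.mem_zpowers _
    | one => exact one_mem _
    | mul a b _ _ ha hb => exact mul_mem ha hb
    | inv a _ ha => exact inv_mem ha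

theorem aux_index {P : Type*} [Group P] [Finite P] {S : Finset P}
    (hcl : Subgroup.closure (S : Set P) = ⊤) (H : Subgroup P) [H.Normal]
    (hsq : ∀ g, g ^ 2 ∈ H) : H.index ∣ 2 ^ S.card := by
  have hcomm := Subgroup.Normal.quotient_commutative_iff_commutator_le.2 (aux_comm_le hsq)
  let _ : CommGroup (P ⧸ H) := { (inferInstance : Group (P ⧸ H)) with mul_comm := hcomm.1.1 }
  have h1 : Nat.card (P ⧸ H) ∣ 2 ^ Group.rank (P ⧸ H) := by
    apply card_dvd_exponent_pow_rank'
    intro q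
    obtain ⟨g, rfl⟩ := QuotientGroup.mk_surjective q
    exact (QuotientGroup.eq_one_iff (g ^ 2)).2 (hsq g)
  have h2 : Group.rank (P ⧸ H) ≤ S.card :=
    (Group.rank_le_of_surjective (QuotientGroup.mk' H) (QuotientGroup.mk'_surjective H)).trans
      (Group.rank_le hcl)
  exact h1.trans (pow_dvd_pow 2 h2)

theorem aux_iso {Q : Type*} [CommGroup Q] [Finite Q] (s w : Q) (m : ℕ) (hs2 : s ^ 2 = 1)
    (hs : s ∉ Subgroup.zpowers w) (hw : orderOf w = 2 ^ m) (hc : Nat.card Q = 2 * 2 ^ m) :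
    Nonempty (Q ≃* Multiplicative (ZMod 2 × ZMod (2 ^ m))) := by
  have hs1 : s ≠ 1 := fun h => hs (h ▸ one_mem _)
  have hos : orderOf s = 2 := orderOf_eq_prime hs2 hs1
  let φ : Subgroup.zpowers s × Subgroup.zpowers w →* Q :=
    (Subgroup.zpowers s).subtype.coprod (Subgroup.zpowers w).subtype
  have hinj : Function.Injective φ := by
    rw [injective_iff_map_eq_one]
    rintro ⟨⟨a, ha⟩, ⟨b, hb⟩⟩ hab
    have hab : a * b = 1 := hab
    obtain ⟨k, rfl⟩ := Subgroup.mem_zpowers_iff.1 ha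
    have hs2' : s ^ (2 : ℤ) = 1 := by exact_mod_cast hs2
    have h1 : s ^ k = 1 := by
      rcases Int.even_or_odd' k with ⟨j, rfl | rfl⟩
      · rw [zpow_mul, hs2', one_zpow]
      · exfalso
        rw [zpow_add, zpow_mul, hs2', one_zpow, one_mul, zpow_one] at hab
        apply hs
        rw [eq_inv_of_mul_eq_one_left hab]
        exact inv_mem hb
    rw [h1, one_mul] at hab
    apply Prod.ext
    · exact Subtype.ext h1
    · exact Subtype.ext hab
  have hbij : Function.Bijective φ := by
    rw [Nat.bijective_iff_injective_and_card]
    refine ⟨hinj, ?_⟩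
    rw [Nat.card_prod, Nat.card_zpowers, Nat.card_zpowers, hos, hw, hc]
  let e1 : Subgroup.zpowers s ≃* Multiplicative (ZMod 2) :=
    mulEquivOfCyclicCardEq (by rw [Nat.card_zpowers, hos]; simp)
  let e2 : Subgroup.zpowers w ≃* Multiplicative (ZMod (2 ^ m)) :=
    mulEquivOfCyclicCardEq (by rw [Nat.card_zpowers, hw]; simp)
  exact ⟨(MulEquiv.ofBijective φ hbij).symm.trans
    ((e1.prodCongr e2).trans (MulEquiv.prodMultiplicative _ _).symm)⟩

theorem aux_abelian {Q : Type*} [CommGroup Q] [Finite Q] (hQ : IsPGroup 2 Q) (Z : Subgroup Q)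
    (hZc : IsCyclic Z) (hZ : Z ≠ ⊥) (hidx : Z.index = 4) (hsq : ∀ q : Q, q ^ 2 ∈ Z)
    (hfr : ∀ H : Subgroup Q, (∀ q : Q, q ^ 2 ∈ H) → H.index ∣ 4) :
    ∃ m : ℕ, 2 ≤ m ∧ Nonempty (Q ≃* Multiplicative (ZMod 2 × ZMod (2 ^ m))) := by
  have : Fact (Nat.Prime 2) := ⟨Nat.prime_two⟩
  let R : Subgroup Q := (powMonoidHom 2 : Q →* Q).range
  have hRZ : R ≤ Z := by
    rintro _ ⟨q, rfl⟩
    exact hsq q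
  have hRe : R = Z := by
    have h1 : R.index ∣ 4 := hfr R (fun q => ⟨q, rfl⟩)
    have h2 : Z.index ∣ R.index := Subgroup.index_dvd_of_le hRZ
    have h3 : R.index = Z.index := Nat.dvd_antisymm (hidx ▸ h1) h2
    have h4 := Subgroup.relIndex_mul_index hRZ
    rw [h3] at h4
    have h5 : R.relIndex Z = 1 := by
      rw [hidx] at h4; omega
    exact le_antisymm hRZ (Subgroup.relIndex_eq_one.1 h5)
  obtain ⟨⟨⟨z, hz⟩, hgen⟩⟩ := hZc
  have hZz : Z = Subgroup.zpowers z := by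
    apply le_antisymm
    · intro a ha
      obtain ⟨k, hk⟩ := hgen ⟨a, ha⟩
      exact ⟨k, congrArg Subtype.val hk⟩
    · rw [Subgroup.zpowers_le]; exact hz
  have hz' : z ∈ R := hRe ▸ hz
  obtain ⟨w, hw⟩ := hz'
  have hw : w ^ 2 = z := hw
  obtain ⟨n, hn⟩ := IsPGroup.iff_orderOf.1 hQ z
  have hn0 : n ≠ 0 := by
    rintro rfl
    apply hZ
    rw [hZz, Subgroup.zpowers_eq_bot, ← orderOf_eq_one_iff, hn, pow_zero]
  obtain ⟨n', rfl⟩ := Nat.exists_eq_succ_of_ne_zero hn0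
  have how : orderOf w = 2 ^ (n' + 2) := by
    apply orderOf_eq_prime_pow
    · intro h
      have : z ^ 2 ^ n' = 1 := by rw [← hw, ← pow_mul, ← pow_succ', h]
      have := orderOf_dvd_of_pow_eq_one this
      rw [hn] at this
      have := (Nat.pow_dvd_pow_iff_le_right (by norm_num : 1 < 2)).1 this
      omega
    · rw [pow_succ', pow_mul, hw, ← Nat.succ_eq_add_one, ← hn, pow_orderOf_eq_one]
  have hcard : Nat.card Q = 2 * 2 ^ (n' + 2) := by
    have := Z.card_mul_index
    rw [hidx, hZz, Nat.card_zpowers, hn] at this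
    rw [← this, Nat.succ_eq_add_one]; ring
  have hex : ∃ t, t ∉ Subgroup.zpowers w := by
    by_contra hcon
    push Not at hcon
    have : Subgroup.zpowers w = ⊤ := by
      rw [eq_top_iff]; intro t _; exact hcon t
    have h2 : Nat.card (Subgroup.zpowers w) = Nat.card Q := by rw [this]; exact Subgroup.card_top
    rw [Nat.card_zpowers, how, hcard] at h2
    have : 0 < 2 ^ (n' + 2) := by positivity
    omega
  obtain ⟨t, ht⟩ := hex
  have ht2 : t ^ 2 ∈ Subgroup.zpowers z := hZz ▸ hsq t
  obtain ⟨k, hk⟩ := Subgroup.mem_zpowers_iff.1 ht2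
  refine ⟨n' + 2, by omega, aux_iso (t * (w ^ k)⁻¹) w _ ?_ ?_ how hcard⟩
  · rw [mul_pow, ← hk, ← hw, inv_pow, ← zpow_natCast (w ^ k), ← zpow_mul, mul_comm k, zpow_mul]
    simp
  · intro h
    apply ht
    have := mul_mem h (Subgroup.zpow_mem_zpowers w k)
    simpa using this

theorem aux_lift {A : Type*} [Group A] {a b : ℕ} [NeZero a] [NeZero b]
    (e : (A ⧸ commutator A) ≃* Multiplicative (ZMod a × ZMod b)) :
    ∃ x y : A, x ^ a ∈ commutator A ∧ y ^ b ∈ commutator A ∧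
      ∀ g : A, ∃ h ∈ commutator A, g = x ^ (e g).toAdd.1.val * y ^ (e g).toAdd.2.val * h := by
  obtain ⟨x, hx⟩ := QuotientGroup.mk_surjective (e.symm (Multiplicative.ofAdd (1, 0)))
  obtain ⟨y, hy⟩ := QuotientGroup.mk_surjective (e.symm (Multiplicative.ofAdd (0, 1)))
  refine ⟨x, y, ?_, ?_, ?_⟩
  · rw [← QuotientGroup.eq_one_iff, QuotientGroup.mk_pow, hx, ← map_pow, ← ofAdd_nsmul]
    simp
  · rw [← QuotientGroup.eq_one_iff, QuotientGroup.mk_pow, hy, ← map_pow, ← ofAdd_nsmul]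
    simp
  · intro g
    refine ⟨(x ^ (e g).toAdd.1.val * y ^ (e g).toAdd.2.val)⁻¹ * g, ?_, by group⟩
    rw [← QuotientGroup.eq, QuotientGroup.mk_mul, QuotientGroup.mk_pow, QuotientGroup.mk_pow, hx, hy,
      ← map_pow e.symm, ← map_pow e.symm, ← map_mul e.symm, ← ofAdd_nsmul, ← ofAdd_nsmul, ← ofAdd_add,
      MulEquiv.symm_apply_eq]
    apply Multiplicative.toAdd.injective
    simp

theorem aux_lift_gen {A : Type*} [Group A] [Finite A] (hA : IsPGroup 2 A) {a b : ℕ} [NeZero a]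
    [NeZero b] (e : (A ⧸ commutator A) ≃* Multiplicative (ZMod a × ZMod b)) :
    ∃ x y : A, x ^ a ∈ commutator A ∧ y ^ b ∈ commutator A ∧ Subgroup.closure {x, y} = ⊤ ∧
      ∀ g : A, ∃ h ∈ commutator A, g = x ^ (e g).toAdd.1.val * y ^ (e g).toAdd.2.val * h := by
  obtain ⟨x, y, hx, hy, h⟩ := aux_lift e
  refine ⟨x, y, hx, hy, aux_gen hA ?_, h⟩
  rw [eq_top_iff]
  intro g _
  obtain ⟨c, hc, hg⟩ := h g
  rw [hg]
  refine mul_mem (Subgroup.mem_sup_left (mul_mem (pow_mem ?_ _) (pow_mem ?_ _)))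
    (Subgroup.mem_sup_right hc)
  · exact Subgroup.subset_closure (by simp)
  · exact Subgroup.subset_closure (by simp)

theorem aux_two_four : ∀ b : ZMod 4, b + b = 0 → ∃ j : ℕ, b.val = 2 * j := by
  intro b hb
  have : b = 0 ∨ b = 2 := by revert b; decide
  rcases this with rfl | rfl
  · exact ⟨0, rfl⟩
  · exact ⟨1, rfl⟩

theorem aux_setup {G : Type*} [Group G] [Finite G] (hG : IsPGroup 2 G)
    (e : (G ⧸ commutator G) ≃* Multiplicative (ZMod 2 × ZMod 4)) :
    ∃ x y : G, Subgroup.closure {x, y} = ⊤ ∧ x ^ 2 ∈ commutator G ∧ y ^ 4 ∈ commutator G ∧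
      ∀ m : G, m ^ 2 ∈ commutator G →
        ∃ i j : ℕ, ∃ g ∈ commutator G, m = x ^ i * (y ^ 2) ^ j * g := by
  obtain ⟨x, y, hx, hy, hcl, h⟩ := aux_lift_gen hG e
  refine ⟨x, y, hcl, hx, hy, fun m hm => ?_⟩
  obtain ⟨c, hc, hg⟩ := h m
  have h0 : (e m).toAdd.2 + (e m).toAdd.2 = 0 := by
    have h1 := (QuotientGroup.eq_one_iff (N := commutator G) (m ^ 2)).2 hm
    have h2 := congrArg (fun q => (e q).toAdd.2) h1
    simpa [pow_two] using h2
  obtain ⟨j, hj⟩ := aux_two_four _ h0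
  refine ⟨(e m).toAdd.1.val, j, c, hc, ?_⟩
  rw [← pow_mul, ← hj]
  exact hg

theorem aux_meta_gen {G : Type*} [Group G] (M N : Subgroup G) [hN : N.Normal]
    (h1 : IsCyclic N) (h2 : IsCyclic (G ⧸ N)) :
    ∃ S : Finset M, S.card ≤ 2 ∧ Subgroup.closure (S : Set M) = ⊤ := by
  classical
  let f : M →* G ⧸ N := (QuotientGroup.mk' N).comp M.subtype
  obtain ⟨⟨⟨_, v, rfl⟩, hv⟩⟩ := (inferInstance : IsCyclic f.range)
  let ι : N.subgroupOf M →* N :=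
    { toFun := fun a => ⟨a.1.1, a.2⟩
      map_one' := rfl
      map_mul' := fun _ _ => rfl }
  have hι : Function.Injective ι := by
    intro a b hab
    have h3 : (ι a : G) = ι b := by rw [hab]
    exact Subtype.ext (Subtype.ext h3)
  obtain ⟨⟨⟨u, hu⟩, hgen⟩⟩ := isCyclic_of_injective ι hι
  refine ⟨{u, v}, Finset.card_le_two, ?_⟩
  rw [eq_top_iff]
  intro m _
  obtain ⟨k, hk⟩ := hv ⟨f m, m, rfl⟩
  have hk : f v ^ k = f m := congrArg Subtype.val hk
  have hmem : m * (v ^ k)⁻¹ ∈ N.subgroupOf M := by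
    have : f (m * (v ^ k)⁻¹) = 1 := by
      rw [map_mul, map_inv, map_zpow, hk, mul_inv_cancel]
    exact (QuotientGroup.eq_one_iff (N := N) ((m * (v ^ k)⁻¹ : M) : G)).1 this
  obtain ⟨j, hj⟩ := hgen ⟨_, hmem⟩
  have hj : u ^ j = m * (v ^ k)⁻¹ := congrArg Subtype.val hj
  rw [eq_mul_inv_iff_mul_eq] at hj
  rw [← hj]
  exact mul_mem (zpow_mem (Subgroup.subset_closure (by simp)) _)
    (zpow_mem (Subgroup.subset_closure (by simp)) _)

theorem metacyclic_iff_maximal_subgroup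
    {G : Type*} [Group G] [Finite G] (hG : IsPGroup 2 G)
    (hnab : ¬ ∀ x y : G, Commute x y)
    (htype : Nonempty ((G ⧸ commutator G) ≃* Multiplicative (ZMod 2 × ZMod 4)))
    (M : Subgroup G) (hMmax : M.index = 2) (hGM : commutator G ≤ M)
    (hMtype : Nonempty ((↥M ⧸ (commutator G).subgroupOf M) ≃*
      Multiplicative (ZMod 2 × ZMod 2))) :
    (IsMetacyclic G ↔
      ∃ m : ℕ, 2 ≤ m ∧
        Nonempty ((↥M ⧸ commutator ↥M) ≃* Multiplicative (ZMod 2 × ZMod (2 ^ m)))) ∧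
    (IsMetacyclic G ↔
      ((∃ S : Finset ↥M, S.card = 2 ∧ Subgroup.closure (S : Set ↥M) = ⊤) ∧
        ∀ S : Finset ↥M, Subgroup.closure (S : Set ↥M) = ⊤ → 2 ≤ S.card)) := by
  classical
  obtain ⟨e⟩ := htype
  obtain ⟨eM⟩ := hMtype
  obtain ⟨x, y, hxy, hx2, hy4, hdec⟩ := aux_setup hG e
  have hMsq' : ∀ m : M, m ^ 2 ∈ (commutator G).subgroupOf M := by
    intro m
    rw [← QuotientGroup.eq_one_iff]
    apply eM.injective
    rw [QuotientGroup.mk_pow, map_pow, map_one]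
    generalize eM m = q
    revert q
    decide
  have hMsq : ∀ m ∈ M, m ^ 2 ∈ commutator G := fun m hm => hMsq' ⟨m, hm⟩
  have hM : ∀ m ∈ M, ∃ i j : ℕ, ∃ g ∈ commutator G, m = x ^ i * (y ^ 2) ^ j * g :=
    fun m hm => hdec m (hMsq m hm)
  have hidx : ((commutator G).subgroupOf M).index = 4 := by
    rw [Subgroup.index, Nat.card_congr eM.toEquiv]
    simp
  have hPM : IsPGroup 2 M := hG.to_subgroup M
  have hlow : ∀ S : Finset M, Subgroup.closure (S : Set M) = ⊤ → 2 ≤ S.card := by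
    intro S hS
    have := aux_index hS _ hMsq'
    rw [hidx] at this
    exact (Nat.pow_dvd_pow_iff_le_right (by norm_num : 1 < 2)).1 (show 2 ^ 2 ∣ 2 ^ S.card from this)
  have h12 : IsMetacyclic G → ∃ m : ℕ, 2 ≤ m ∧
        Nonempty ((↥M ⧸ commutator ↥M) ≃* Multiplicative (ZMod 2 × ZMod (2 ^ m))) := by
    rintro ⟨N, hN, cN, cGN⟩
    obtain ⟨S, hS2, hS⟩ := aux_meta_gen M N cN cGN
    have hGN : commutator G ≤ N := by
      rw [← Subgroup.Normal.quotient_commutative_iff_commutator_le]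
      infer_instance
    have hbot : (⊥ : Subgroup G) < commutator G := by
      rw [bot_lt_iff_ne_bot]
      intro h
      apply hnab
      intro a b
      have : ⁅a, b⁆ ∈ commutator G :=
        Subgroup.commutator_mem_commutator (Subgroup.mem_top a) (Subgroup.mem_top b)
      rw [h, Subgroup.mem_bot] at this
      exact commutatorElement_eq_one_iff_commute.1 this
    obtain ⟨L, -, hL⟩ := aux_exists_good hG ⊥ hbot
    have hML : commutator M ≤ L.subgroupOf M := by
      refine Subgroup.commutator_le.2 ?_
      rintro ⟨a, ha⟩ - ⟨b, hb⟩ -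
      exact (aux_mod hL hM).1 a ha b hb
    let f : M →* Abelianization M := Abelianization.of
    have hf : Function.Surjective f := QuotientGroup.mk_surjective
    have hker : f.ker = commutator M := Abelianization.ker_of M
    have hle : commutator M ≤ (commutator G).subgroupOf M :=
      hML.trans (Subgroup.comap_mono hL.2.1.le)
    refine aux_abelian (Q := Abelianization M) (hPM.of_surjective f hf)
      (((commutator G).subgroupOf M).map f) ?_ ?_ ?_ ?_ ?_
    · let ι : (commutator G).subgroupOf M →* N :=
        { toFun := fun a => ⟨a.1.1, hGN a.2⟩
          map_one' := rfl
          map_mul' := fun _ _ => rfl }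
      have hι : Function.Injective ι := by
        intro a b hab
        have h3 : (ι a : G) = ι b := by rw [hab]
        exact Subtype.ext (Subtype.ext h3)
      have := isCyclic_of_injective ι hι
      exact isCyclic_of_surjective (f.subgroupMap ((commutator G).subgroupOf M))
        (f.subgroupMap_surjective _)
    · intro h
      rw [Subgroup.map_eq_bot_iff, hker] at h
      have h2 : commutator G ≤ L := fun g hg =>
        (h.trans hML) (show (⟨g, hGM hg⟩ : M) ∈ (commutator G).subgroupOf M from hg)
      exact absurd (hL.2.1.trans_le h2) (lt_irrefl _)
    · rw [Subgroup.index_map_eq _ hf (hker ▸ hle), hidx]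
    · intro q
      obtain ⟨m, rfl⟩ := hf q
      exact ⟨m ^ 2, hMsq' m, map_pow f m 2⟩
    · intro H hH
      rw [← Subgroup.index_comap_of_surjective H hf]
      refine (aux_index hS (H.comap f) ?_).trans (pow_dvd_pow 2 hS2)
      intro g
      rw [Subgroup.mem_comap, map_pow]
      exact hH _
  have h23 : (∃ m : ℕ, 2 ≤ m ∧
        Nonempty ((↥M ⧸ commutator ↥M) ≃* Multiplicative (ZMod 2 × ZMod (2 ^ m)))) →
      ∃ S : Finset ↥M, S.card = 2 ∧ Subgroup.closure (S : Set ↥M) = ⊤ := by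
    rintro ⟨m, -, ⟨e'⟩⟩
    obtain ⟨s, t, -, -, hst, -⟩ := aux_lift_gen hPM e'
    have h : Subgroup.closure ((({s, t} : Finset M) : Finset M) : Set M) = ⊤ := by
      rw [← hst]; simp
    exact ⟨{s, t}, le_antisymm Finset.card_le_two (hlow _ h), h⟩
  have h31 : (∃ S : Finset ↥M, S.card = 2 ∧ Subgroup.closure (S : Set ↥M) = ⊤) →
      IsMetacyclic G := by
    rintro ⟨S, hS2, hS⟩
    by_cases hA : commutator G ≤ Subgroup.normalClosure {x ^ 2}
    · exact aux_meta hG hxy (Subgroup.mem_zpowers x) hA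
    by_cases hB : commutator G ≤ Subgroup.normalClosure {(y ^ 2) ^ 2}
    · exact aux_meta hG (by rw [Set.pair_comm]; exact hxy)
        (Subgroup.pow_mem _ (Subgroup.mem_zpowers y) 2) hB
    exfalso
    have hy4' : (y ^ 2) ^ 2 ∈ commutator G := by rw [← pow_mul]; exact hy4
    have hA' : Subgroup.normalClosure {x ^ 2} ≤ commutator G :=
      Subgroup.normalClosure_le_normal (by simpa using hx2)
    have hB' : Subgroup.normalClosure {(y ^ 2) ^ 2} ≤ commutator G :=
      Subgroup.normalClosure_le_normal (by simpa using hy4')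
    obtain ⟨L, hAL, hL⟩ := aux_exists_good hG _ (lt_of_le_not_ge hA' hA)
    obtain ⟨L', hBL, hL'⟩ := aux_exists_good hG _ (lt_of_le_not_ge hB' hB)
    have hx : x ^ 2 ∈ L := hAL (Subgroup.subset_normalClosure rfl)
    have hy : y ^ 4 ∈ L := by
      apply aux_unique hxy hL' hL
      apply hBL
      have : y ^ 4 = (y ^ 2) ^ 2 := by rw [← pow_mul]
      rw [this]
      exact Subgroup.subset_normalClosure rfl
    have hsq := (aux_mod hL hM).2 hx hy
    have hLn : L.Normal := hL.1
    have hi : (L.subgroupOf M).index ∣ 2 ^ S.card :=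
      aux_index hS (L.subgroupOf M) (fun g => hsq g g.2)
    rw [hS2] at hi
    have hle : L.subgroupOf M ≤ (commutator G).subgroupOf M := Subgroup.comap_mono hL.2.1.le
    have h4 := Subgroup.relIndex_mul_index hle
    rw [hidx] at h4
    have hpos : (L.subgroupOf M).index ≤ 4 := Nat.le_of_dvd (by norm_num) hi
    have hne : (L.subgroupOf M).index ≠ 0 := Subgroup.index_ne_zero_of_finite
    have h5 : (L.subgroupOf M).relIndex ((commutator G).subgroupOf M) = 1 := by
      omega
    have h6 := Subgroup.relIndex_eq_one.1 h5
    have h7 : commutator G ≤ L := fun g hg =>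
      h6 (show (⟨g, hGM hg⟩ : M) ∈ (commutator G).subgroupOf M from hg)
    exact absurd (hL.2.1.trans_le h7) (lt_irrefl _)
  exact ⟨⟨h12, fun h => h31 (h23 h)⟩, ⟨fun h => ⟨h23 (h12 h), hlow⟩, fun h => h31 h.1⟩⟩
end

section
/- Let G be a 2-group with G/G' of type (2,4), let M be the maximal subgroup with M/G' of type (2,2), and let H be a maximal subgroup with H/G' cyclic of order 4. Then the following are equivalent: (1) G is abelian; (2) M/M' is of type (2,2); (3) H is cyclic of order 4. -/
open scoped commutatorElement
theorem aux_zmod2 : ∀ a : ZMod 2, 0 = a ∨ 1 = a := by decide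

theorem aux_zmod4 : ∀ a : ZMod 4, a + a = 0 → ∃ w : ZMod 4, a = w + w := by decide

theorem aux_zmod (a b : ZMod 2 × ZMod 4) (ha : a + a = 0) (hb : b + b = 0) :
    ∃ w : ZMod 2 × ZMod 4, a = w + w ∨ b = w + w ∨ a + b = w + w := by
  obtain ⟨a1, a2⟩ := a
  obtain ⟨b1, b2⟩ := b
  obtain ⟨u, hu⟩ := aux_zmod4 a2 (congrArg Prod.snd ha)
  obtain ⟨v, hv⟩ := aux_zmod4 b2 (congrArg Prod.snd hb)
  have h0 : (0 : ZMod 2) = 0 + 0 := by decide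
  have h1 : (1 : ZMod 2) + 1 = 0 + 0 := by decide
  rcases aux_zmod2 a1 with rfl | rfl
  · exact ⟨(0, u), Or.inl (Prod.ext h0 hu)⟩
  rcases aux_zmod2 b1 with rfl | rfl
  · exact ⟨(0, v), Or.inr (Or.inl (Prod.ext h0 hv))⟩
  · refine ⟨(0, u + v), Or.inr (Or.inr (Prod.ext h1 ?_))⟩
    change a2 + b2 = (u + v) + (u + v)
    rw [hu, hv]; ring

theorem aux_comm_sq {Q : Type*} [Group Q] (hc : ∀ z ∈ commutator Q, ∀ g : Q, g * z = z * g)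
    (a b w : Q) (h : a * (w * w)⁻¹ ∈ commutator Q) : ⁅a, b⁆ = ⁅w, b⁆ ^ 2 := by
  have hz : ⁅w, b⁆ ∈ commutator Q :=
    Subgroup.commutator_mem_commutator (Subgroup.mem_top _) (Subgroup.mem_top _)
  obtain ⟨c, hcd⟩ : ∃ c, c = a * (w * w)⁻¹ := ⟨_, rfl⟩
  rw [← hcd] at h
  have ha : a = c * (w * w) := by rw [hcd]; group
  obtain ⟨z, hzd⟩ : ∃ z, z = ⁅w, b⁆ := ⟨_, rfl⟩
  rw [← hzd] at hz ⊢
  have hwb : w * b = z * (b * w) := by rw [hzd, commutatorElement_def]; group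
  have key : a * b = z ^ 2 * (b * a) := by
    calc a * b = c * (w * (w * b)) := by rw [ha]; group
      _ = c * ((w * z) * (b * w)) := by rw [hwb]; group
      _ = c * (z * (w * b) * w) := by rw [hc z hz w]; group
      _ = (c * z) * z * b * w * w := by rw [hwb]; group
      _ = z * (c * z) * b * w * w := by
        rw [hc z hz c]; simp only [mul_assoc]; rw [← mul_assoc c z, hc z hz c]; simp only [mul_assoc]
      _ = z * z * (c * b) * w * w := by rw [hc z hz c]; simp only [mul_assoc]
      _ = z ^ 2 * (b * a) := by rw [← hc c h b, ha, pow_two]; simp only [mul_assoc]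
  rw [commutatorElement_def, key]; group

theorem aux_nilp {G : Type*} [Group G] [Group.IsNilpotent G]
    (h : commutator G ≤ ⁅commutator G, (⊤ : Subgroup G)⁆) : commutator G = ⊥ := by
  have hn : ∀ n, commutator G ≤ Subgroup.lowerCentralSeries (⊤ : Subgroup G) n := by
    intro n
    induction n with
    | zero => simp
    | succ k ih => exact h.trans (Subgroup.commutator_mono ih le_rfl)
  obtain ⟨n, hn'⟩ := Subgroup.nilpotent_iff_lowerCentralSeries.1 ‹Group.IsNilpotent G›
  exact le_bot_iff.1 (hn' ▸ hn n)

theorem aux_sq {Q : Type*} [Group Q] [Finite Q] (hQ : IsPGroup 2 Q) (C : Subgroup Q)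
    (h : ∀ q ∈ C, ∃ r ∈ C, r ^ 2 = q) : C = ⊥ := by
  by_contra hne
  have hp : IsPGroup 2 C := hQ.to_subgroup C
  have hnt : Nontrivial C := (Subgroup.nontrivial_iff_ne_bot C).2 hne
  have : Fact (Nat.Prime 2) := ⟨Nat.prime_two⟩
  obtain ⟨g, hg⟩ := exists_prime_orderOf_dvd_card' (G := C) 2
    (by
      obtain ⟨n, hn, hn'⟩ := hp.nontrivial_iff_card.1 hnt
      rw [hn']; exact dvd_pow_self 2 (by omega))
  have hs : Function.Surjective (fun x : C => x ^ 2) := by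
    rintro ⟨q, hq⟩
    obtain ⟨r, hr, e⟩ := h q hq
    exact ⟨⟨r, hr⟩, Subtype.ext e⟩
  have hi := Finite.injective_iff_surjective.2 hs
  have : g = 1 := hi (by simp [← hg, pow_orderOf_eq_one])
  rw [this] at hg
  simp at hg

theorem aux_main {G : Type*} [Group G] [Finite G] (hG : IsPGroup 2 G)
    (e : (G ⧸ commutator G) ≃* Multiplicative (ZMod 2 × ZMod 4))
    (M : Subgroup G) (hsq : ∀ a ∈ M, a * a ∈ commutator G)
    (hM : commutator G ≤ ⁅M, M⁆) : commutator G = ⊥ := by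
  have : Fact (Nat.Prime 2) := ⟨Nat.prime_two⟩
  have := hG.isNilpotent
  apply aux_nilp
  let K : Subgroup G := ⁅commutator G, (⊤ : Subgroup G)⁆
  let π : G →* G ⧸ K := QuotientGroup.mk' K
  have hπ : Function.Surjective π := QuotientGroup.mk'_surjective K
  have hmap : (commutator G).map π = commutator (G ⧸ K) := by
    change Subgroup.map π ⁅(⊤ : Subgroup G), (⊤ : Subgroup G)⁆ = ⁅⊤, ⊤⁆
    rw [Subgroup.map_commutator, Subgroup.map_top_of_surjective π hπ]
  have hc : ∀ z ∈ commutator (G ⧸ K), ∀ g : G ⧸ K, g * z = z * g := by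
    intro z hz g
    rw [← hmap] at hz
    obtain ⟨z, hz, rfl⟩ := hz
    obtain ⟨g, rfl⟩ := hπ g
    have : π ⁅z, g⁆ = 1 := (QuotientGroup.eq_one_iff _).2
      (Subgroup.commutator_mem_commutator hz (Subgroup.mem_top g))
    rw [map_commutatorElement, commutatorElement_eq_one_iff_mul_comm] at this
    exact this.symm
  have hK : commutator (G ⧸ K) = ⊥ := by
    apply aux_sq (hG.to_quotient K)
    let S : Subgroup (G ⧸ K) :=
      { carrier := {q | ∃ r ∈ commutator (G ⧸ K), r ^ 2 = q}
        one_mem' := ⟨1, one_mem _, one_pow 2⟩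
        mul_mem' := by
          rintro _ _ ⟨r, hr, rfl⟩ ⟨s, hs, rfl⟩
          exact ⟨r * s, mul_mem hr hs, (show Commute r s from hc s hs r).mul_pow 2⟩
        inv_mem' := by
          rintro _ ⟨r, hr, rfl⟩
          exact ⟨r⁻¹, inv_mem hr, inv_pow r 2⟩ }
    have hMS : ⁅M, M⁆ ≤ S.comap π := by
      rw [Subgroup.commutator_le]
      intro a ha b hb
      have hin : ∀ u v : G ⧸ K, ⁅u, v⁆ ∈ commutator (G ⧸ K) := fun u v =>
        Subgroup.commutator_mem_commutator (Subgroup.mem_top _) (Subgroup.mem_top _)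
      have h2 : ∀ a ∈ M, (e (a : G)).toAdd + (e (a : G)).toAdd = 0 := by
        intro a ha
        rw [← toAdd_mul, ← map_mul, ← QuotientGroup.mk_mul,
          (QuotientGroup.eq_one_iff _).2 (hsq a ha), map_one, toAdd_one]
      have hlift : ∀ a w : G, (e (a : G)).toAdd = (e (w : G)).toAdd + (e (w : G)).toAdd →
          π a * (π w * π w)⁻¹ ∈ commutator (G ⧸ K) := by
        intro a w h
        rw [← toAdd_mul, ← map_mul, ← QuotientGroup.mk_mul] at h
        have h' := e.injective (Multiplicative.toAdd.injective h)
        rw [← hmap, ← map_mul, ← map_inv, ← map_mul]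
        apply Subgroup.mem_map_of_mem
        rw [← QuotientGroup.eq_one_iff, QuotientGroup.mk_mul, QuotientGroup.mk_inv, h',
          mul_inv_cancel]
      obtain ⟨w, hw⟩ := aux_zmod _ _ (h2 a ha) (h2 b hb)
      obtain ⟨w, rfl⟩ : ∃ g : G, (e (g : G)).toAdd = w := by
        obtain ⟨g, hg⟩ := QuotientGroup.mk_surjective (e.symm (Multiplicative.ofAdd w))
        exact ⟨g, by rw [hg]; simp⟩
      have hinv : ∀ u v : G ⧸ K, ⁅v, u⁆ ∈ S → ⁅u, v⁆ ∈ S := by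
        intro u v h
        rw [← commutatorElement_inv]; exact inv_mem h
      rw [Subgroup.mem_comap, map_commutatorElement]
      rcases hw with h | h | h
      · rw [aux_comm_sq hc _ (π b) _ (hlift a w h)]
        exact ⟨_, hin _ _, rfl⟩
      · apply hinv
        rw [aux_comm_sq hc _ (π a) _ (hlift b w h)]
        exact ⟨_, hin _ _, rfl⟩
      · rw [← toAdd_mul, ← map_mul, ← QuotientGroup.mk_mul] at h
        have h3 := aux_comm_sq hc _ (π b) _ (hlift (a * b) w h)
        have h4 : ⁅π a, π b⁆ = ⁅π (a * b), π b⁆ := by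
          rw [map_mul, commutatorElement_def, commutatorElement_def]; group
        rw [h4, h3]
        exact ⟨_, hin _ _, rfl⟩
    intro q hq
    rw [← hmap] at hq
    obtain ⟨g, hg, rfl⟩ := hq
    exact hMS (hM hg)
  intro g hg
  have : π g ∈ commutator (G ⧸ K) := hmap ▸ Subgroup.mem_map_of_mem π hg
  rw [hK, Subgroup.mem_bot] at this
  exact (QuotientGroup.eq_one_iff g).1 this


/-- Let `G` be a finite 2-group with `G/G'` of type `(2,4)`, let `M` be the
maximal subgroup with `M/G'` of type `(2,2)`, and `H` a maximal subgroup with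
`H/G'` cyclic of order 4. TFAE: (1) `G` is abelian;
(2) `M/M'` is of type `(2,2)`; (3) `H` is cyclic of order 4. -/
theorem abelian_iff_maximal_subgroups
    {G : Type*} [Group G] [Finite G] (hG : IsPGroup 2 G)
    (htype : Nonempty ((G ⧸ commutator G) ≃* Multiplicative (ZMod 2 × ZMod 4)))
    (M : Subgroup G) (hMmax : M.index = 2) (hGM : commutator G ≤ M)
    (hMtype : Nonempty ((↥M ⧸ (commutator G).subgroupOf M) ≃*
      Multiplicative (ZMod 2 × ZMod 2)))
    (H : Subgroup G) (hHmax : H.index = 2) (hGH : commutator G ≤ H)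
    (hHtype : Nonempty ((↥H ⧸ (commutator G).subgroupOf H) ≃*
      Multiplicative (ZMod 4))) :
    ((∀ x y : G, Commute x y) ↔
      Nonempty ((↥M ⧸ commutator ↥M) ≃* Multiplicative (ZMod 2 × ZMod 2))) ∧
    ((∀ x y : G, Commute x y) ↔ (IsCyclic ↥H ∧ Nat.card ↥H = 4)) := by
  have hab : (∀ x y : G, Commute x y) ↔ commutator G = ⊥ := by
    rw [commutator_def, Subgroup.commutator_eq_bot_iff_le_centralizer]
    constructor
    · intro h x _ y _
      exact h y x
    · intro h x y
      exact h (Subgroup.mem_top y) x (Subgroup.mem_top x)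
  have hcard : Nat.card (G ⧸ commutator G) = 8 := by
    rw [Nat.card_congr htype.some.toEquiv]; simp
  have hle : commutator M ≤ (commutator G).subgroupOf M := by
    rw [commutator_def, Subgroup.commutator_le]
    intro a _ b _
    rw [Subgroup.mem_subgroupOf]
    exact Subgroup.commutator_mem_commutator (Subgroup.mem_top (a : G)) (Subgroup.mem_top (b : G))
  refine ⟨⟨fun h => ?_, fun h => ?_⟩, fun h => ?_, fun h => ?_⟩
  · have h1 : (commutator G).subgroupOf M = ⊥ := by rw [hab.1 h]; simp
    have h2 : commutator M = (commutator G).subgroupOf M := by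
      rw [h1] at hle ⊢; exact le_bot_iff.1 hle
    exact ⟨(QuotientGroup.quotientMulEquivOfEq h2).trans hMtype.some⟩
  · rw [hab]
    have i1 : (commutator M).index = 4 := by
      rw [Subgroup.index, Nat.card_congr h.some.toEquiv]; simp
    have i2 : ((commutator G).subgroupOf M).index = 4 := by
      rw [Subgroup.index, Nat.card_congr hMtype.some.toEquiv]; simp
    have heq : (commutator G).subgroupOf M ≤ commutator M := by
      have := Subgroup.relIndex_mul_index hle
      rw [i1, i2] at this
      exact Subgroup.relIndex_eq_one.1 (by omega)
    refine aux_main hG htype.some M ?_ ?_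
    · intro a ha
      have h2 : ∀ x : Multiplicative (ZMod 2 × ZMod 2), x * x = 1 := by decide
      have h3 := h2 (hMtype.some ((⟨a, ha⟩ : M) : M ⧸ (commutator G).subgroupOf M))
      rw [← map_mul, ← QuotientGroup.mk_mul, map_eq_one_iff _ hMtype.some.injective,
        QuotientGroup.eq_one_iff] at h3
      exact h3
    · intro g hg
      have h1 : (⟨g, hGM hg⟩ : M) ∈ commutator M := heq hg
      have h2 := Subgroup.mem_map_of_mem M.subtype h1
      rw [commutator_def, Subgroup.map_commutator] at h2
      rwa [← MonoidHom.range_eq_map, Subgroup.range_subtype] at h2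
  · have h1 : (commutator G).subgroupOf H = ⊥ := by rw [hab.1 h]; simp
    have f : H ≃* Multiplicative (ZMod 4) :=
      (QuotientGroup.quotientBot.symm.trans (QuotientGroup.quotientMulEquivOfEq h1.symm)).trans
        hHtype.some
    exact ⟨isCyclic_of_surjective f.symm f.symm.surjective, by
      rw [Nat.card_congr f.toEquiv]; simp⟩
  · rw [hab]
    have h1 := H.card_mul_index
    rw [h.2, hHmax] at h1
    have h2 := (commutator G).card_mul_index
    rw [Subgroup.index, hcard, ← h1] at h2
    exact Subgroup.card_eq_one.1 (by omega)
end
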